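/- Let Ω ∈ K^n/ℤ^n with 𝔻_Ω = {1,…,l} (up to order) and 𝒟_Ω = {1,…,m} for some 1 ≤ m ≤ l ≤ n. Set k = n−m, D_k = K[H_{m+1},…,H_n], B_k = ⊗_{i=m+1}^n B_1(i), and let 𝔪′ = (H_{m+1},…,H_l, H_{l+1}−λ_{l+1},…,H_n−λ_n). For every ideal I of D_k with 𝔪′ ⊇ I ⊇ (𝔪′)^i for some i ≥ 1, the 𝕀_n-module V(I) := P_m ⊗ (B_k ⊗_{D_k} D_k/I) belongs to GW(𝕀_n, 𝒟_Ω) and is an indecomposable, equidimensional, generalized weight 𝕀_n-module of length d := dim_K(D_k/I) < ∞; it is isomorphic to ⊕_{α∈ℤ^k} P_m ⊗ ∂^α D_k/I, satisfies dim_K V(I)^𝔫 = d for all 𝔫 ∈ Supp(V(I)) = Supp(M(𝒟_Ω)), and its annihilator is the prime ideal Σ_{i∉𝒟_Ω} 𝔭_i. -/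

import Mathlib

set_option maxHeartbeats 1000000
set_option synthInstance.maxHeartbeats 400000
set_option linter.unusedSectionVars false

namespace IDO

open scoped TensorProduct

noncomputable section

variable (K : Type*) [Field K] [CharZero K] (n : ℕ)

/-- The polynomial algebra `P_n = K[x_1, …, x_n]`. -/
abbrev P := MvPolynomial (Fin n) K

/-- The multiplication operator `x_i`. -/
def xOp (i : Fin n) : Module.End K (P K n) := LinearMap.mulLeft K (MvPolynomial.X i)

/-- The partial derivative `∂_i`. -/
def dOp (i : Fin n) : Module.End K (P K n) := (MvPolynomial.pderiv i).toLinearMap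

/-- The integration operator `∫_i`, sending `x^α ↦ x^{α+e_i}/(α_i+1)`. -/
def intOp (i : Fin n) : Module.End K (P K n) :=
  ((MvPolynomial.basisMonomials (Fin n) K).constr K)
    (fun α => (((α i : ℕ) : K) + 1)⁻¹ •
      (MvPolynomial.monomial (α + Finsupp.single i 1) (1 : K)))

/-- The algebra of polynomial integro-differential operators `𝕀_n`, as a subalgebra of
`End_K(P_n)` generated by the `x_i`, `∂_i` and `∫_i`. -/
def InSub : Subalgebra K (Module.End K (P K n)) :=
  Algebra.adjoin K (Set.range (xOp K n) ∪ Set.range (dOp K n) ∪ Set.range (intOp K n))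

/-- The algebra `𝕀_n` (as a type, with its canonical ring structure). -/
def In : Type _ := InSub K n

instance : Ring (In K n) := inferInstanceAs (Ring (InSub K n))
instance : Algebra K (In K n) := inferInstanceAs (Algebra K (InSub K n))
instance : Module (In K n) (P K n) := inferInstanceAs (Module (InSub K n) (P K n))
instance : IsScalarTower K (In K n) (P K n) :=
  inferInstanceAs (IsScalarTower K (InSub K n) (P K n))

/-- `x_i` as an element of `𝕀_n`. -/
def xEl (i : Fin n) : In K n :=
  show InSub K n from
    ⟨xOp K n i, Algebra.subset_adjoin (Set.mem_union_left _ (Set.mem_union_left _ ⟨i, rfl⟩))⟩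

/-- `∂_i` as an element of `𝕀_n`. -/
def dEl (i : Fin n) : In K n :=
  show InSub K n from
    ⟨dOp K n i, Algebra.subset_adjoin (Set.mem_union_left _ (Set.mem_union_right _ ⟨i, rfl⟩))⟩

/-- `∫_i` as an element of `𝕀_n`. -/
def intEl (i : Fin n) : In K n :=
  show InSub K n from
    ⟨intOp K n i, Algebra.subset_adjoin (Set.mem_union_right _ ⟨i, rfl⟩)⟩

/-- `H_i = ∂_i x_i` as an element of `𝕀_n`. -/
def HEl (i : Fin n) : In K n := dEl K n i * xEl K n i

section Modules

variable (M : Type*) [AddCommGroup M] [Module K M] [Module (In K n) M]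
  [IsScalarTower K (In K n) M]

/-- The weight space `M_λ = {m | H_i m = λ_i m for all i}`. -/
def weightSpace (lam : Fin n → K) : Submodule K M where
  carrier := {m | ∀ i, HEl K n i • m = lam i • m}
  add_mem' := by
    intro a b ha hb i
    rw [smul_add, ha i, hb i, smul_add]
  zero_mem' := by intro i; simp
  smul_mem' := by
    intro c m hm i
    rw [← smul_comm c (HEl K n i) m, hm i, smul_smul, mul_comm, ← smul_smul]

private lemma pow_smul_zero_mono {a : In K n} {m : M} {s s' : ℕ}
    (h : (a ^ s) • m = 0) (hle : s ≤ s') : (a ^ s') • m = 0 := by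
  obtain ⟨k, rfl⟩ := Nat.exists_eq_add_of_le hle
  rw [add_comm s k, pow_add, mul_smul, h, smul_zero]

/-- The generalized weight space `M^λ = {m | (H_i − λ_i)^N m = 0 for some N and all i}`. -/
def genWeightSpace (lam : Fin n → K) : Submodule K M where
  carrier := {m | ∃ N : ℕ, ∀ i,
    ((HEl K n i - algebraMap K (In K n) (lam i)) ^ N) • m = 0}
  add_mem' := by
    rintro a b ⟨Na, ha⟩ ⟨Nb, hb⟩
    refine ⟨Na ⊔ Nb, fun i => ?_⟩
    rw [smul_add, pow_smul_zero_mono K n M (ha i) le_sup_left,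
      pow_smul_zero_mono K n M (hb i) le_sup_right, add_zero]
  zero_mem' := ⟨0, fun i => smul_zero _⟩
  smul_mem' := by
    rintro c m ⟨N, hN⟩
    exact ⟨N, fun i => by rw [← smul_comm c _ m, hN i, smul_zero]⟩

/-- `M` is a weight module: `M = ⊕_λ M_λ`. -/
def IsWeightModule : Prop :=
  letI := Classical.decEq (Fin n → K)
  DirectSum.IsInternal (fun lam : Fin n → K => weightSpace K n M lam)

/-- `M` is a generalized weight module: `M = ⊕_λ M^λ`. -/
def IsGenWeightModule : Prop :=
  letI := Classical.decEq (Fin n → K)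
  DirectSum.IsInternal (fun lam : Fin n → K => genWeightSpace K n M lam)

/-- The support `Supp(M) = {λ | M^λ ≠ 0}`. -/
def supp : Set (Fin n → K) := {lam | genWeightSpace K n M lam ≠ ⊥}

/-- `M` is an indecomposable `𝕀_n`-module. -/
def IsIndecomposableMod : Prop :=
  Nontrivial M ∧ ∀ p q : Submodule (In K n) M, IsCompl p q → p = ⊥ ∨ q = ⊥

/-- The annihilator of an `𝕀_n`-module, as a set. -/
def annSet : Set (In K n) := {a | ∀ m : M, a • m = 0}

end Modules

/-- A prime (two-sided) ideal of the noncommutative ring `𝕀_n`, given as a set: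
`S ≠ 𝕀_n` and `a 𝕀_n b ⊆ S → a ∈ S ∨ b ∈ S`. -/
def IsPrimeSet (S : Set (In K n)) : Prop :=
  S ≠ Set.univ ∧ ∀ a b : In K n, (∀ r : In K n, a * r * b ∈ S) → a ∈ S ∨ b ∈ S

-- orbits
/-- The `ℤ^n`-orbit of `λ ∈ K^n`. -/
def orbitOf (lam : Fin n → K) : Set (Fin n → K) :=
  {mu | ∀ i, ∃ z : ℤ, mu i - lam i = (z : K)}

/-- The setoid on `K^n` whose classes are the `ℤ^n`-orbits. -/
def orbitSetoid : Setoid (Fin n → K) where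
  r mu nu := ∀ i, ∃ z : ℤ, mu i - nu i = (z : K)
  iseqv := by
    constructor
    · intro x i; exact ⟨0, by simp⟩
    · intro x y h i
      obtain ⟨z, hz⟩ := h i
      exact ⟨-z, by push_cast; linear_combination -hz⟩
    · intro x y z hxy hyz i
      obtain ⟨a, ha⟩ := hxy i
      obtain ⟨b, hb⟩ := hyz i
      exact ⟨a + b, by push_cast; linear_combination ha + hb⟩

/-- `𝔻_Ω = {i | Ω_i = ℤ}` for the orbit `Ω` of `λ`. -/
def DD (lam : Fin n → K) : Set (Fin n) := {i | ∃ z : ℤ, lam i = (z : K)}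

/-- `λ` is the normalized representative of its orbit: integer coordinates are `0`. -/
def IsNormalized (lam : Fin n → K) : Prop := ∀ i, (∃ z : ℤ, lam i = (z : K)) → lam i = 0


-- I_1 specifics
/-- The matrix units `e_{st} = ∫^s ∂^t − ∫^{s+1} ∂^{t+1}` of `𝕀_1`. -/
def eEl1 (s t : ℕ) : In K 1 :=
  intEl K 1 0 ^ s * dEl K 1 0 ^ t - intEl K 1 0 ^ (s + 1) * dEl K 1 0 ^ (t + 1)

/-- `F = ⊕ K e_{st}`, the unique proper two-sided ideal of `𝕀_1`, here as the left ideal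
generated by the `e_{st}` (the two coincide). -/
def Fideal : Submodule (In K 1) (In K 1) :=
  Submodule.span (In K 1) {a | ∃ s t : ℕ, a = eEl1 K s t}

/-- The left ideal `F + 𝕀_1 (H − μ)^s`. -/
def MslIdeal (s : ℕ) (mu : K) : Submodule (In K 1) (In K 1) :=
  Fideal K ⊔ Submodule.span (In K 1) {(HEl K 1 0 - algebraMap K (In K 1) mu) ^ s}

/-- The `𝕀_1`-module `M(s,μ) = 𝕀_1/(F + 𝕀_1 (H − μ)^s)`. -/
def Msl (s : ℕ) (mu : K) := (In K 1) ⧸ MslIdeal K s mu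

instance (s : ℕ) (mu : K) : AddCommGroup (Msl K s mu) :=
  inferInstanceAs (AddCommGroup ((In K 1) ⧸ MslIdeal K s mu))
instance (s : ℕ) (mu : K) : Module (In K 1) (Msl K s mu) :=
  inferInstanceAs (Module (In K 1) ((In K 1) ⧸ MslIdeal K s mu))
instance (s : ℕ) (mu : K) : Module K (Msl K s mu) :=
  inferInstanceAs (Module K ((In K 1) ⧸ MslIdeal K s mu))
instance (s : ℕ) (mu : K) : IsScalarTower K (In K 1) (Msl K s mu) :=
  inferInstanceAs (IsScalarTower K (In K 1) ((In K 1) ⧸ MslIdeal K s mu))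

-- two-sided ideals of I_n
/-- The element `e_{st}(i) ∈ 𝕀_n` built from the `i`-th tensor factor. -/
def eElN (i : Fin n) (s t : ℕ) : In K n :=
  intEl K n i ^ s * dEl K n i ^ t - intEl K n i ^ (s + 1) * dEl K n i ^ (t + 1)

/-- The height one prime `𝔭_i`, the two-sided ideal of `𝕀_n` generated by `F(i)`. -/
def pIdeal (i : Fin n) : TwoSidedIdeal (In K n) :=
  TwoSidedIdeal.span {a | ∃ s t : ℕ, a = eElN K n i s t}

/-- `𝔞_n(I) = Σ_{i ∈ I} 𝔭_i`. -/
def aIdeal (I : Set (Fin n)) : TwoSidedIdeal (In K n) := ⨆ i ∈ I, pIdeal K n i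


-- bundled modules
universe u

/-- A bundled `𝕀_n`-module (with compatible `K`-structure). -/
structure ModN (K : Type u) [Field K] [CharZero K] (n : ℕ) : Type (u + 1) where
  carrier : Type u
  [instAdd : AddCommGroup carrier]
  [instK : Module K carrier]
  [instIn : Module (In K n) carrier]
  [instTower : IsScalarTower K (In K n) carrier]

attribute [instance] ModN.instAdd ModN.instK ModN.instIn ModN.instTower

/-- The endomorphism of `M_1 ⊗ ⋯ ⊗ M_n` acting by `a ∈ 𝕀_1` on the `i`-th factor. -/
def tprodMap (Mi : Fin n → ModN K 1) (i : Fin n) (a : In K 1) :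
    (⨂[K] j, (Mi j).carrier) →ₗ[K] ⨂[K] j, (Mi j).carrier :=
  PiTensorProduct.map (Function.update
    (fun j => (LinearMap.id : (Mi j).carrier →ₗ[K] (Mi j).carrier)) i
    (DistribMulAction.toLinearMap K ((Mi i).carrier) a))

/-- The `𝕀_n`-module `M` "is" the tensor product `M_1 ⊗ ⋯ ⊗ M_n` of the `𝕀_1`-modules `M_i`:
there is a `K`-linear isomorphism under which the generators `x_i, ∂_i, ∫_i` of `𝕀_n` act on
the `i`-th tensor factor via the corresponding generators of `𝕀_1`. -/
def RealizesTensor (Mi : Fin n → ModN K 1) (M : Type*) [AddCommGroup M] [Module K M]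
    [Module (In K n) M] [IsScalarTower K (In K n) M] : Prop :=
  ∃ φ : M ≃ₗ[K] ⨂[K] j, (Mi j).carrier,
    ∀ (i : Fin n) (m : M),
      φ (xEl K n i • m) = tprodMap K n Mi i (xEl K 1 0) (φ m) ∧
      φ (dEl K n i • m) = tprodMap K n Mi i (dEl K 1 0) (φ m) ∧
      φ (intEl K n i • m) = tprodMap K n Mi i (intEl K 1 0) (φ m)

/-- `M` is (isomorphic to) the simple weight module `M(𝒟_Ω)` attached to the orbit of `λ`
and the subset `𝒟 ⊆ 𝔻_Ω`: the tensor product of copies of `K[x]` (for `i ∈ 𝒟`) and of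
`M(1, λ_i)` (for `i ∉ 𝒟`). -/
def RealizesMD (lam : Fin n → K) (D : Set (Fin n)) (M : Type*) [AddCommGroup M] [Module K M]
    [Module (In K n) M] [IsScalarTower K (In K n) M] : Prop :=
  ∃ Mi : Fin n → ModN K 1,
    (∀ i, i ∈ D → Nonempty ((Mi i).carrier ≃ₗ[In K 1] P K 1)) ∧
    (∀ i, i ∉ D → Nonempty ((Mi i).carrier ≃ₗ[In K 1] Msl K 1 (lam i))) ∧
    RealizesTensor K n Mi M

/-- `M` is (isomorphic to) the module `P_{n-1} ⊗ M(s, λ)` (with the copy of `M(s,λ)` placed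
in position `j`). -/
def RealizesPMs (lam : Fin n → K) (j : Fin n) (s : ℕ) (M : Type*) [AddCommGroup M] [Module K M]
    [Module (In K n) M] [IsScalarTower K (In K n) M] : Prop :=
  ∃ Mi : Fin n → ModN K 1,
    (∀ i, i ≠ j → Nonempty ((Mi i).carrier ≃ₗ[In K 1] P K 1)) ∧
    Nonempty ((Mi j).carrier ≃ₗ[In K 1] Msl K s (lam j)) ∧
    RealizesTensor K n Mi M

/-- Membership in the category `GW(𝕀_n, 𝒟_Ω)`: generalized weight modules with support in the
orbit of `λ` all of whose simple subquotients are isomorphic to `M(𝒟_Ω)`. -/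
def InGWD (lam : Fin n → K) (D : Set (Fin n)) (M : Type*) [AddCommGroup M] [Module K M]
    [Module (In K n) M] [IsScalarTower K (In K n) M] : Prop :=
  IsGenWeightModule K n M ∧ supp K n M ⊆ orbitOf K n lam ∧
  ∀ (p q : Submodule (In K n) M), p ≤ q →
    IsSimpleModule (In K n) (q ⧸ Submodule.comap q.subtype p) →
    RealizesMD K n lam D (q ⧸ Submodule.comap q.subtype p)

/-- The support `S(𝒟_Ω) = ℕ_+^{𝒟_Ω} × ∏_{i ∉ 𝒟_Ω} (λ_i + ℤ)` of the module `M(𝒟_Ω)`. -/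
def SuppMD (lam : Fin n → K) (D : Set (Fin n)) : Set (Fin n → K) :=
  {mu | (∀ i ∈ D, ∃ m : ℕ, 0 < m ∧ mu i = (m : K)) ∧
        (∀ i ∉ D, ∃ z : ℤ, mu i = lam i + (z : K))}

/-- `M` is an absolutely prime `𝕀_n`-module: its annihilator is a prime ideal and every
nonzero subfactor of `M` has the same annihilator. -/
def IsAbsolutelyPrime (M : Type*) [AddCommGroup M] [Module K M]
    [Module (In K n) M] [IsScalarTower K (In K n) M] : Prop :=
  IsPrimeSet K n (annSet K n M) ∧
  ∀ (p q : Submodule (In K n) M), p ≤ q →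
    Nontrivial (q ⧸ Submodule.comap q.subtype p) →
    annSet K n (q ⧸ Submodule.comap q.subtype p) = annSet K n M


-- the commutative subalgebra D_n = K[H_1, …, H_n]
lemma xEl_smul (i : Fin n) (p : P K n) : xEl K n i • p = MvPolynomial.X i * p := rfl

lemma dEl_smul (i : Fin n) (p : P K n) : dEl K n i • p = MvPolynomial.pderiv i p := rfl

lemma hEl_monomial (i : Fin n) (α : Fin n →₀ ℕ) (c : K) :
    HEl K n i • (MvPolynomial.monomial α c : P K n)
      = (((α i : ℕ) : K) + 1) • MvPolynomial.monomial α c := by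
  have hx : xEl K n i • (MvPolynomial.monomial α c : P K n)
      = MvPolynomial.monomial (α + Finsupp.single i 1) c := by
    rw [xEl_smul, MvPolynomial.X, MvPolynomial.monomial_mul, one_mul, add_comm]
  rw [HEl, mul_smul, hx, dEl_smul, MvPolynomial.pderiv_monomial,
    add_tsub_cancel_right, MvPolynomial.smul_monomial, Finsupp.add_apply,
    Finsupp.single_eq_same, smul_eq_mul]
  congr 1
  push_cast
  ring

private lemma In_ext {a b : In K n} (h : ∀ p : P K n, a • p = b • p) : a = b := by
  have : (show InSub K n from a) = (show InSub K n from b) :=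
    Subtype.ext (LinearMap.ext fun p => h p)
  exact this

lemma hEl_comm (i j : Fin n) : HEl K n i * HEl K n j = HEl K n j * HEl K n i := by
  apply In_ext
  intro p
  induction p using MvPolynomial.induction_on' with
  | monomial α c =>
      have key : ∀ a b : Fin n, (HEl K n a * HEl K n b) • (MvPolynomial.monomial α c : P K n)
          = ((((α b : ℕ) : K) + 1) * (((α a : ℕ) : K) + 1)) • MvPolynomial.monomial α c := by
        intro a b
        rw [mul_smul, hEl_monomial, ← smul_comm, hEl_monomial, smul_smul]
      rw [key, key, mul_comm]
  | add p q hp hq =>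
      rw [smul_add, smul_add, hp, hq]

/-- `D_n = K[H_1, …, H_n]` as a subalgebra of `𝕀_n`. -/
def DnSub : Subalgebra K (In K n) := Algebra.adjoin K (Set.range (HEl K n))

/-- The commutative algebra `D_n` (as a type). -/
def Dn : Type _ := DnSub K n

instance : CommRing (Dn K n) :=
  Algebra.adjoinCommRingOfComm K (by rintro a ⟨i, rfl⟩ b ⟨j, rfl⟩; exact hEl_comm K n i j)

instance : Algebra K (Dn K n) := inferInstanceAs (Algebra K (DnSub K n))

/-- The inclusion `D_n → 𝕀_n`. -/
def dnVal : Dn K n →+* In K n := ((DnSub K n).val : DnSub K n →ₐ[K] In K n).toRingHom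

/-- `H_i` as an element of `D_n`. -/
def HElD (i : Fin n) : Dn K n :=
  show DnSub K n from ⟨HEl K n i, Algebra.subset_adjoin ⟨i, rfl⟩⟩

lemma dn_comm (d : Dn K n) (i : Fin n) :
    dnVal K n d * HEl K n i = HEl K n i * dnVal K n d := by
  have h1 : DnSub K n ≤ Subalgebra.centralizer K (Set.range (HEl K n)) := by
    apply Algebra.adjoin_le
    rintro x ⟨j, rfl⟩
    rw [SetLike.mem_coe, Subalgebra.mem_centralizer_iff]
    rintro g ⟨i', rfl⟩
    exact hEl_comm K n i' j
  have h2 := (Subalgebra.mem_centralizer_iff K).mp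
    (h1 (show DnSub K n from d).2) (HEl K n i) ⟨i, rfl⟩
  exact h2.symm


section DnModules

variable (M : Type*) [AddCommGroup M] [Module K M] [Module (In K n) M]
  [IsScalarTower K (In K n) M]

lemma genWS_stable (lam : Fin n → K) {m : M} (hm : m ∈ genWeightSpace K n M lam)
    (d : Dn K n) : dnVal K n d • m ∈ genWeightSpace K n M lam := by
  obtain ⟨N, hN⟩ := hm
  refine ⟨N, fun i => ?_⟩
  have hc : Commute (dnVal K n d) ((HEl K n i - algebraMap K (In K n) (lam i)) ^ N) := by
    apply Commute.pow_right
    exact Commute.sub_right (dn_comm K n d i) ((Algebra.commutes (lam i) (dnVal K n d)).symm)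
  rw [← mul_smul, ← hc.eq, mul_smul, hN i, smul_zero]

instance genWS_smul (lam : Fin n → K) : SMul (Dn K n) (genWeightSpace K n M lam) :=
  ⟨fun d w => ⟨dnVal K n d • (w : M), genWS_stable K n M lam w.2 d⟩⟩

instance genWS_module (lam : Fin n → K) : Module (Dn K n) (genWeightSpace K n M lam) :=
  Module.ofMinimalAxioms
    (fun d x y => Subtype.ext (smul_add (dnVal K n d) (x : M) (y : M)))
    (fun d d' x => Subtype.ext (show dnVal K n (d + d') • (x : M)
      = dnVal K n d • (x : M) + dnVal K n d' • (x : M) by rw [map_add, add_smul]))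
    (fun d d' x => Subtype.ext (show dnVal K n (d * d') • (x : M)
      = dnVal K n d • (dnVal K n d' • (x : M)) by rw [map_mul, mul_smul]))
    (fun x => Subtype.ext (show dnVal K n 1 • (x : M) = (x : M) by rw [map_one, one_smul]))

instance genWS_tower (lam : Fin n → K) :
    IsScalarTower K (Dn K n) (genWeightSpace K n M lam) :=
  ⟨fun c d w => Subtype.ext (show dnVal K n (c • d) • (w : M) = c • (dnVal K n d • (w : M)) by
    rw [show dnVal K n (c • d) = c • dnVal K n d from map_smul (DnSub K n).val c d, smul_assoc])⟩

end DnModules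

/-- The maximal ideal `𝔪_λ = (H_1 − λ_1, …, H_n − λ_n)` of `D_n`. -/
def mIdeal (lam : Fin n → K) : Ideal (Dn K n) :=
  Ideal.span {d | ∃ i, d = HElD K n i - algebraMap K (Dn K n) (lam i)}

/-- The category `LF_𝔪(D_n)` of `𝔪_λ`-locally finite `D_n`-modules: every cyclic submodule is
finite dimensional over `K` and annihilated by a power of `𝔪_λ`. -/
def IsLF (lam : Fin n → K) (N : Type*) [AddCommGroup N] [Module K N] [Module (Dn K n) N]
    [IsScalarTower K (Dn K n) N] : Prop :=
  ∀ x : N, FiniteDimensional K ((Submodule.span (Dn K n) {x}).restrictScalars K) ∧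
    ∃ s : ℕ, ∀ i, ((HElD K n i - algebraMap K (Dn K n) (lam i)) ^ s) • x = 0

-- the algebra B_n = 𝕀_n/𝔞_n
/-- The maximal ideal `𝔞_n = 𝔭_1 + ⋯ + 𝔭_n` of `𝕀_n`. -/
def aFull : TwoSidedIdeal (In K n) := aIdeal K n Set.univ

/-- The skew Laurent polynomial algebra `B_n = 𝕀_n/𝔞_n`. -/
def Bn : Type _ := (aFull K n).ringCon.Quotient

instance : Ring (Bn K n) := inferInstanceAs (Ring (aFull K n).ringCon.Quotient)

/-- The quotient map `𝕀_n → B_n`. -/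
def toBn : In K n →+* Bn K n := RingCon.mk' _

lemma toBn_surjective : Function.Surjective (toBn K n) :=
  Quotient.mk''_surjective

/-- The composite `D_n → 𝕀_n → B_n`. -/
def bnD : Dn K n →+* Bn K n := (toBn K n).comp (dnVal K n)

/-- `B_n` as a right `D_n`-module (written as a left module structure, `d • b = b ⬝ d`). -/
instance : SMul (Dn K n) (Bn K n) := ⟨fun d b => b * bnD K n d⟩

instance : Module (Dn K n) (Bn K n) :=
  Module.ofMinimalAxioms
    (fun d x y => show (x + y) * bnD K n d = x * bnD K n d + y * bnD K n d from add_mul _ _ _)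
    (fun d d' x => show x * bnD K n (d + d') = x * bnD K n d + x * bnD K n d' by
      rw [map_add, mul_add])
    (fun d d' x => show x * bnD K n (d * d') = (x * bnD K n d') * bnD K n d by
      rw [mul_comm d d', map_mul, ← mul_assoc])
    (fun x => show x * bnD K n 1 = x by rw [map_one, mul_one])

instance : SMulCommClass (Dn K n) (Bn K n) (Bn K n) :=
  ⟨fun d b m => show (b * m) * bnD K n d = b * (m * bnD K n d) from mul_assoc b m (bnD K n d)⟩

/-- The induced module `B_n ⊗_{D_n} N` of a `D_n`-module `N`. -/
def Ind (N : Type*) [AddCommGroup N] [Module (Dn K n) N] : Type _ :=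
  (Bn K n) ⊗[Dn K n] N

section Ind

variable (N : Type*) [AddCommGroup N] [Module (Dn K n) N]

instance : AddCommGroup (Ind K n N) :=
  inferInstanceAs (AddCommGroup ((Bn K n) ⊗[Dn K n] N))

instance indModuleBn : Module (Bn K n) (Ind K n N) :=
  inferInstanceAs (Module (Bn K n) ((Bn K n) ⊗[Dn K n] N))

instance indModuleDn : Module (Dn K n) (Ind K n N) :=
  inferInstanceAs (Module (Dn K n) ((Bn K n) ⊗[Dn K n] N))

instance indModuleIn : Module (In K n) (Ind K n N) := Module.compHom _ (toBn K n)

instance indModuleK : Module K (Ind K n N) := Module.compHom _ (algebraMap K (Dn K n))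

lemma bn_algebraMap_comm (c : K) (u : Bn K n) :
    toBn K n (algebraMap K (In K n) c) * u = u * toBn K n (algebraMap K (In K n) c) := by
  obtain ⟨r, rfl⟩ := toBn_surjective K n u
  rw [← map_mul, ← map_mul, Algebra.commutes]

lemma dnVal_algebraMap (c : K) :
    dnVal K n (algebraMap K (Dn K n) c) = algebraMap K (In K n) c :=
  AlgHom.commutes (DnSub K n).val c

lemma ind_key (c : K) (w : (Bn K n) ⊗[Dn K n] N) :
    (toBn K n (algebraMap K (In K n) c)) • w = (algebraMap K (Dn K n) c) • w := by
  induction w using TensorProduct.induction_on with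
  | zero => rw [smul_zero, smul_zero]
  | tmul b x =>
      rw [TensorProduct.smul_tmul', TensorProduct.smul_tmul']
      congr 1
      show toBn K n (algebraMap K (In K n) c) * b = b * bnD K n (algebraMap K (Dn K n) c)
      have h1 : bnD K n (algebraMap K (Dn K n) c) = toBn K n (algebraMap K (In K n) c) := by
        show toBn K n (dnVal K n (algebraMap K (Dn K n) c)) = _
        rw [dnVal_algebraMap]
      rw [h1, bn_algebraMap_comm]
  | add x y hx hy => rw [smul_add, smul_add, hx, hy]

instance indTower : IsScalarTower K (In K n) (Ind K n N) := by
  constructor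
  intro c a v
  show toBn K n (c • a) • v = algebraMap K (Dn K n) c • ((toBn K n a : Bn K n) • v)
  rw [Algebra.smul_def, map_mul, mul_smul]
  exact ind_key K n N c _

end Ind


section BnQuot

variable (J : Submodule (Bn K n) (Bn K n))

instance : Module (In K n) (Bn K n ⧸ J) := Module.compHom _ (toBn K n)

instance : Module K (Bn K n ⧸ J) :=
  Module.compHom _ ((toBn K n).comp (algebraMap K (In K n)))

instance : IsScalarTower K (In K n) (Bn K n ⧸ J) := by
  constructor
  intro c a v
  show toBn K n (c • a) • v = (toBn K n (algebraMap K (In K n) c)) • (toBn K n a • v)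
  rw [Algebra.smul_def, map_mul, mul_smul]

end BnQuot

/-- The `𝕀_n`-module `M` "is" the tensor product `A ⊗ B` of an `𝕀_m`-module `A` and an
`𝕀_{n-m}`-module `B`: there is a `K`-linear isomorphism under which the generators of `𝕀_n`
with index `< m` act on the first factor (via the corresponding generators of `𝕀_m`) and the
remaining generators act on the second factor (via the generators of `𝕀_{n-m}`). -/
def RealizesSplit (m : ℕ) (A : Type*) [AddCommGroup A] [Module K A] [Module (In K m) A]
    [IsScalarTower K (In K m) A]
    (B : Type*) [AddCommGroup B] [Module K B] [Module (In K (n - m)) B]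
    [IsScalarTower K (In K (n - m)) B]
    (M : Type*) [AddCommGroup M] [Module K M] [Module (In K n) M]
    [IsScalarTower K (In K n) M] : Prop :=
  ∃ φ : M ≃ₗ[K] A ⊗[K] B,
    (∀ (i : Fin n) (hi : (i : ℕ) < m) (v : M),
      φ (xEl K n i • v) = LinearMap.rTensor B
        (DistribMulAction.toLinearMap K A (xEl K m ⟨i, hi⟩)) (φ v) ∧
      φ (dEl K n i • v) = LinearMap.rTensor B
        (DistribMulAction.toLinearMap K A (dEl K m ⟨i, hi⟩)) (φ v) ∧
      φ (intEl K n i • v) = LinearMap.rTensor B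
        (DistribMulAction.toLinearMap K A (intEl K m ⟨i, hi⟩)) (φ v)) ∧
    (∀ (i : Fin n) (hi : m ≤ (i : ℕ)) (v : M),
      φ (xEl K n i • v) = LinearMap.lTensor A
        (DistribMulAction.toLinearMap K B (xEl K (n - m) ⟨(i : ℕ) - m, by omega⟩)) (φ v) ∧
      φ (dEl K n i • v) = LinearMap.lTensor A
        (DistribMulAction.toLinearMap K B (dEl K (n - m) ⟨(i : ℕ) - m, by omega⟩)) (φ v) ∧
      φ (intEl K n i • v) = LinearMap.lTensor A
        (DistribMulAction.toLinearMap K B (intEl K (n - m) ⟨(i : ℕ) - m, by omega⟩)) (φ v))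

end


noncomputable section StdSec

lemma In_ext2 {K : Type*} [Field K] [CharZero K] {n : ℕ} {a b : In K n}
    (h : ∀ p : P K n, a • p = b • p) : a = b := by
  have : (show InSub K n from a) = (show InSub K n from b) :=
    Subtype.ext (LinearMap.ext fun p => h p)
  exact this

/-- Explicit description of the modules under study. -/
structure Std {K : Type*} [Field K] [CharZero K] {n : ℕ} (D : Set (Fin n)) (lam : Fin n → K)
    {A : Type*} [CommRing A] [Algebra K A] (t : Fin n → A)
    (N : Type*) [AddCommGroup N] [Module K N] [Module A N] [IsScalarTower K A N]
    (V : Type*) [AddCommGroup V] [Module K V] [Module (In K n) V]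
    [IsScalarTower K (In K n) V] where
  ι : (Fin n → ℤ) → N →ₗ[K] V
  π : (Fin n → ℤ) → V →ₗ[K] N
  lam0 : ∀ i ∈ D, lam i = 0
  t0 : ∀ i ∈ D, t i = 0
  zero : ∀ w i, i ∈ D → w i ≤ 0 → ι w = 0
  π_same : ∀ w, (∀ i ∈ D, 0 < w i) → ∀ y, π w (ι w y) = y
  π_ne : ∀ w w', w ≠ w' → ∀ y, π w (ι w' y) = 0
  span : ∀ v, v ∈ ⨆ w, LinearMap.range (ι w)
  hd : ∀ i w y, dEl K n i • ι w y = ι (w - Pi.single i 1) y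
  hint : ∀ i w y, (i ∈ D → 0 < w i) → intEl K n i • ι w y = ι (w + Pi.single i 1) y
  hx : ∀ i w y, xEl K n i • ι w y = ι (w + Pi.single i 1) ((lam i + (w i : K)) • y + t i • y)

section PStd
variable {K : Type*} [Field K] [CharZero K] {n : ℕ}

def expo (w : Fin n → ℤ) : Fin n →₀ ℕ := Finsupp.equivFunOnFinite.symm fun i => (w i - 1).toNat

@[simp] lemma expo_apply (w : Fin n → ℤ) (i) : expo w i = (w i - 1).toNat := rfl

variable (K) in
def fac (w : Fin n → ℤ) : K := ∏ i, (((w i - 1).toNat.factorial : ℕ) : K)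

lemma fac_ne (w : Fin n → ℤ) : fac K w ≠ 0 :=
  Finset.prod_ne_zero_iff.2 fun i _ => by exact_mod_cast Nat.factorial_ne_zero _

lemma expo_add (w : Fin n → ℤ) (i) (h : 0 < w i) :
    expo (w + Pi.single i 1) = expo w + Finsupp.single i 1 := by
  ext j
  by_cases hj : j = i
  · subst hj
    simp; omega
  · simp [Pi.single_eq_of_ne hj, Finsupp.single_eq_of_ne hj]

lemma fac_add (w : Fin n → ℤ) (i) (h : 0 < w i) :
    fac K (w + Pi.single i 1) = (w i : K) * fac K w := by
  classical
  unfold fac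
  rw [← Finset.mul_prod_erase _ _ (Finset.mem_univ i), ← Finset.mul_prod_erase _ (fun i => (((w i - 1).toNat.factorial : ℕ) : K)) (Finset.mem_univ i),
    ← mul_assoc]
  congr 1
  · obtain ⟨m, hm⟩ : ∃ m : ℕ, w i = m + 1 := ⟨(w i - 1).toNat, by omega⟩
    simp only [Pi.add_apply, Pi.single_eq_same, hm]
    have h1 : ((m : ℤ) + 1 + 1 - 1).toNat = m + 1 := by omega
    have h2 : ((m : ℤ) + 1 - 1).toNat = m := by omega
    rw [h1, h2, Nat.factorial_succ]
    push_cast; ring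
  · refine Finset.prod_congr rfl fun j hj => ?_
    simp [Pi.single_eq_of_ne (Finset.ne_of_mem_erase hj)]

lemma intEl_monomial (i : Fin n) (α : Fin n →₀ ℕ) (c : K) :
    intEl K n i • (MvPolynomial.monomial α c : P K n)
      = MvPolynomial.monomial (α + Finsupp.single i 1) ((((α i : ℕ) : K) + 1)⁻¹ * c) := by
  have h1 : (MvPolynomial.monomial α c : P K n) = c • (MvPolynomial.basisMonomials (Fin n) K) α := by
    simp [MvPolynomial.smul_monomial]
  have h2 : ∀ p : P K n, intEl K n i • p = intOp K n i p := fun _ => rfl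
  rw [h2, h1, map_smul, intOp, Module.Basis.constr_basis, MvPolynomial.smul_monomial, MvPolynomial.smul_monomial]
  congr 1
  simp [mul_comm]

open Classical in
def Pι (w : Fin n → ℤ) : K →ₗ[K] P K n :=
  if ∀ i, 0 < w i then (fac K w)⁻¹ • MvPolynomial.monomial (expo w) else 0

lemma Pι_pos (w : Fin n → ℤ) (h : ∀ i, 0 < w i) (c : K) :
    Pι w c = MvPolynomial.monomial (expo w) ((fac K w)⁻¹ * c) := by
  rw [Pι, if_pos h]; simp [MvPolynomial.smul_monomial]

lemma Pι_neg (w : Fin n → ℤ) (h : ¬ ∀ i, 0 < w i) : Pι w = (0 : K →ₗ[K] P K n) := by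
  rw [Pι, if_neg h]

lemma pos_add (w : Fin n → ℤ) (i) (h : ∀ j, 0 < w j) : ∀ j, 0 < (w + Pi.single i 1 : Fin n → ℤ) j := by
  intro j
  by_cases hj : j = i
  · subst hj; simp; have := h j; omega
  · simp [Pi.single_eq_of_ne hj, h j]

open Classical in
def stdP : Std (Set.univ : Set (Fin n)) (0 : Fin n → K) (0 : Fin n → K) K (P K n) where
  ι := Pι
  π w := if ∀ i, 0 < w i then fac K w • MvPolynomial.lcoeff K (expo w) else 0
  lam0 := by simp
  t0 := by simp
  zero w i _ h := Pι_neg w (fun h' => by have := h' i; omega)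
  π_same w h y := by
    have h : ∀ i, 0 < w i := fun i => h i trivial
    rw [if_pos h, Pι_pos w h]
    simp [MvPolynomial.lcoeff, MvPolynomial.coeff_monomial, fac_ne]
  π_ne w w' hne y := by
    split_ifs with h
    · by_cases h' : ∀ i, 0 < w' i
      · rw [Pι_pos w' h']
        have : expo w' ≠ expo w := by
          intro he
          apply hne
          ext i
          have := DFunLike.congr_fun he i
          simp at this
          have := h i
          have := h' i
          omega
        simp [MvPolynomial.lcoeff, MvPolynomial.coeff_monomial, this]
      · rw [Pι_neg w' h']; simp
    · simp
  span v := by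
    induction v using MvPolynomial.induction_on' with
    | monomial α c =>
      let w : Fin n → ℤ := fun i => α i + 1
      have hw : ∀ i, 0 < w i := fun i => by simp [w]
      refine Submodule.mem_iSup_of_mem w ⟨fac K w * c, ?_⟩
      rw [Pι_pos w hw]
      congr 1
      · congr 1
        ext i; simp [w]
      · field_simp [fac_ne]
    | add p q hp hq => exact Submodule.add_mem _ hp hq
  hd i w y := by
    by_cases h : ∀ i, 0 < w i
    · rw [Pι_pos w h, dEl_smul, MvPolynomial.pderiv_monomial]
      by_cases h1 : w i = 1
      · rw [Pι_neg _ (fun h' => by have := h' i; simp at this; omega)]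
        simp [h1]
      · have h' : ∀ j, 0 < (w - Pi.single i 1 : Fin n → ℤ) j := by
          intro j
          by_cases hj : j = i
          · subst hj; simp; have := h j; omega
          · simp [Pi.single_eq_of_ne hj, h j]
        rw [Pι_pos _ h']
        have e : w = (w - Pi.single i 1) + Pi.single i 1 := by simp
        have e1 := expo_add _ i (h' i)
        have e2 := fac_add (K := K) _ i (h' i)
        rw [← e] at e1 e2
        rw [e1, e2]
        rw [add_tsub_cancel_right]
        congr 1
        have h3 : ((w - Pi.single i 1 : Fin n → ℤ) i : K) ≠ 0 := by
          have := h' i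
          exact_mod_cast this.ne'
        have h4 := fac_ne (K := K) (w - Pi.single i 1)
        have h5 : (((expo (w - Pi.single i 1) + Finsupp.single i 1 : Fin n →₀ ℕ) i : ℕ) : K) = ((w - Pi.single i 1 : Fin n → ℤ) i : K) := by
          have := h' i
          simp only [Finsupp.add_apply, expo_apply, Finsupp.single_eq_same]
          obtain ⟨m, hm⟩ : ∃ m : ℕ, (w - Pi.single i 1 : Fin n → ℤ) i = m + 1 := ⟨((w - Pi.single i 1 : Fin n → ℤ) i - 1).toNat, by omega⟩
          rw [hm]; simp
        rw [h5]
        field_simp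
    · rw [Pι_neg w h, Pι_neg]
      · simp
      · intro h'
        apply h
        intro j
        have := h' j
        by_cases hj : j = i
        · subst hj; simp at this; omega
        · simpa [Pi.single_eq_of_ne hj] using this
  hint i w y hi := by
    by_cases h : ∀ i, 0 < w i
    · rw [Pι_pos w h, Pι_pos _ (pos_add w i h), intEl_monomial, expo_add _ _ (h i), fac_add _ _ (h i)]
      congr 1
      have h5 : ((expo w i : ℕ) : K) + 1 = (w i : K) := by
          have := h i
          simp only [expo_apply]
          obtain ⟨m, hm⟩ : ∃ m : ℕ, w i = m + 1 := ⟨(w i - 1).toNat, by omega⟩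
          rw [hm]; simp
      rw [h5, mul_inv, mul_assoc]
    · have := hi trivial
      rw [Pι_neg w h, Pι_neg]
      · simp
      · intro h'
        apply h
        intro j
        have := h' j
        by_cases hj : j = i
        · subst hj; assumption
        · simpa [Pi.single_eq_of_ne hj] using this
  hx i w y := by
    by_cases h : ∀ i, 0 < w i
    · rw [Pι_pos w h, Pι_pos _ (pos_add w i h), xEl_smul, expo_add _ _ (h i), fac_add _ _ (h i),
        MvPolynomial.X, MvPolynomial.monomial_mul, add_comm, one_mul]
      congr 1
      have h3 : (w i : K) ≠ 0 := by
          have := h i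
          exact_mod_cast this.ne'
      have h4 := fac_ne (K := K) w
      simp
      field_simp
    · by_cases hw : w i = 0
      · simp [hw, Pι_neg w h]
      rw [Pι_neg w h, Pι_neg]
      · simp
      · intro h'
        apply h
        intro j
        have := h' j
        by_cases hj : j = i
        · subst hj; simp at this; omega
        · simpa [Pi.single_eq_of_ne hj] using this

end PStd

end StdSec

noncomputable section StdSec2

lemma In_induction {K : Type*} [Field K] [CharZero K] {n : ℕ} {p : In K n → Prop}
    (one : p 1) (add : ∀ a b, p a → p b → p (a + b)) (smul : ∀ (c : K) a, p a → p (c • a))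
    (hx : ∀ i a, p a → p (xEl K n i * a)) (hd : ∀ i a, p a → p (dEl K n i * a))
    (hint : ∀ i a, p a → p (intEl K n i * a)) (a : In K n) : p a := by
  have key : ∀ T : Module.End K (P K n), T ∈ Submodule.span K
      ((Submonoid.closure (Set.range (xOp K n) ∪ Set.range (dOp K n) ∪ Set.range (intOp K n)) :
        Submonoid _) : Set (Module.End K (P K n))) →
      ∃ a : In K n, (∀ q : P K n, a • q = T q) ∧ p a := by
    intro T hT
    induction hT using Submodule.span_induction with
    | mem T hT =>
      induction hT using Submonoid.closure_induction_left with
      | one => exact ⟨1, fun q => one_smul _ q, one⟩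
      | mul_left g hg y hy ih =>
        obtain ⟨a, h, ih⟩ := ih
        rcases hg with (⟨i, rfl⟩ | ⟨i, rfl⟩) | ⟨i, rfl⟩
        · exact ⟨_, fun q => by rw [mul_smul, h]; rfl, hx i _ ih⟩
        · exact ⟨_, fun q => by rw [mul_smul, h]; rfl, hd i _ ih⟩
        · exact ⟨_, fun q => by rw [mul_smul, h]; rfl, hint i _ ih⟩
    | zero =>
      exact ⟨_, fun q => by rw [zero_smul, zero_smul]; rfl, smul 0 1 one⟩
    | add x y _ _ hx hy =>
      obtain ⟨a, h1, hx⟩ := hx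
      obtain ⟨b, h2, hy⟩ := hy
      exact ⟨_, fun q => by rw [add_smul, h1, h2]; rfl, add _ _ hx hy⟩
    | smul c x _ hx =>
      obtain ⟨a, h1, hx⟩ := hx
      exact ⟨_, fun q => by rw [smul_assoc, h1]; rfl, smul c _ hx⟩
  have h2 : (show InSub K n from a).1 ∈ Subalgebra.toSubmodule (Algebra.adjoin K (Set.range (xOp K n) ∪ Set.range (dOp K n) ∪ Set.range (intOp K n))) :=
    (show InSub K n from a).2
  rw [Algebra.adjoin_eq_span] at h2
  obtain ⟨b, hb, hp⟩ := key _ h2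
  have : a = b := In_ext2 fun q => (hb q).symm
  rw [this]; exact hp

namespace Std

variable {K : Type*} [Field K] [CharZero K] {n : ℕ} {D : Set (Fin n)} {lam : Fin n → K}
    {A : Type*} [CommRing A] [Algebra K A] {t : Fin n → A}
    {N : Type*} [AddCommGroup N] [Module K N] [Module A N] [IsScalarTower K A N]
    {V : Type*} [AddCommGroup V] [Module K V] [Module (In K n) V]
    [IsScalarTower K (In K n) V] (S : Std D lam t N V)

include S

lemma ind {p : V → Prop} (h0 : p 0) (hι : ∀ w, (∀ i ∈ D, 0 < w i) → ∀ y, p (S.ι w y))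
    (hadd : ∀ u v, p u → p v → p (u + v)) (v : V) : p v := by
  refine Submodule.iSup_induction _ (motive := p) (S.span v) ?_ h0 hadd
  rintro w _ ⟨y, rfl⟩
  by_cases h : ∀ i ∈ D, 0 < w i
  · exact hι w h y
  · push Not at h
    obtain ⟨i, hi, h⟩ := h
    rw [S.zero w i hi h]; simpa

lemma decomp (v : V) : ∃ s : Finset (Fin n → ℤ), ∀ s', s ⊆ s' → v = ∑ w ∈ s', S.ι w (S.π w v) := by
  classical
  induction v using S.ind with
  | h0 => exact ⟨∅, fun s' _ => by simp⟩
  | hι w hw y =>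
    refine ⟨{w}, fun s' hs => ?_⟩
    rw [Finset.sum_eq_single w]
    · rw [S.π_same w hw]
    · intro b _ hb
      rw [S.π_ne b w hb, map_zero]
    · intro h; exact absurd (hs (by simp)) h
  | hadd u v hu hv =>
    obtain ⟨s, hs⟩ := hu
    obtain ⟨s1, hs1⟩ := hv
    refine ⟨s ∪ s1, fun s' h => ?_⟩
    simp only [map_add, Finset.sum_add_distrib]
    rw [← hs s' (Finset.union_subset_left h), ← hs1 s' (Finset.union_subset_right h)]

lemma eq_zero (v : V) (h : ∀ w, S.π w v = 0) : v = 0 := by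
  obtain ⟨s, hs⟩ := S.decomp v
  rw [hs s subset_rfl]
  simp [h]

omit S in
variable (lam t) in
def wt (w : Fin n → ℤ) (i : Fin n) : A := algebraMap K A (lam i + (w i : K)) + t i

lemma hx' (i w y) : xEl K n i • S.ι w y = S.ι (w + Pi.single i 1) (wt lam t w i • y) := by
  rw [S.hx, wt, add_smul (algebraMap K A _), algebraMap_smul]

lemma hH (i w y) : HEl K n i • S.ι w y = S.ι w (wt lam t w i • y) := by
  rw [HEl, mul_smul, S.hx', S.hd, add_sub_cancel_right]

lemma hint0 (i w y) (hi : i ∈ D) (h : w i ≤ 0) : intEl K n i • S.ι w y = 0 := by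
  rw [S.zero w i hi h]; simp

lemma hu_pos (i) (z : ℕ) (w y) (h : i ∈ D → 0 < w i) :
    intEl K n i ^ z • S.ι w y = S.ι (w + Pi.single i (z : ℤ)) y := by
  induction z with
  | zero => simp
  | succ z ih =>
    rw [pow_succ', mul_smul, ih, S.hint]
    · rw [add_assoc, ← Pi.single_add]; push_cast; rfl
    · intro hi; have := h hi; simp; omega

lemma hu_neg (i) (z : ℕ) (w y) :
    dEl K n i ^ z • S.ι w y = S.ι (w - Pi.single i (z : ℤ)) y := by
  induction z with
  | zero => simp
  | succ z ih =>
    rw [pow_succ', mul_smul, ih, S.hd]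
    · rw [sub_sub, ← Pi.single_add]; push_cast; rfl

end Std

section vEl
variable {K : Type*} [Field K] [CharZero K] {n : ℕ}

variable (K) in
def uEl (i : Fin n) (z : ℤ) : In K n := intEl K n i ^ z.toNat * dEl K n i ^ (-z).toNat

variable (K) in
def vEl (z : Fin n → ℤ) : In K n := ((List.finRange n).map fun i => uEl K i (z i)).prod

end vEl

namespace Std

variable {K : Type*} [Field K] [CharZero K] {n : ℕ} {D : Set (Fin n)} {lam : Fin n → K}
    {A : Type*} [CommRing A] [Algebra K A] {t : Fin n → A}
    {N : Type*} [AddCommGroup N] [Module K N] [Module A N] [IsScalarTower K A N]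
    {V : Type*} [AddCommGroup V] [Module K V] [Module (In K n) V]
    [IsScalarTower K (In K n) V] (S : Std D lam t N V)

lemma hu (i z w y) (h : i ∈ D → 0 < w i) :
    uEl K i z • S.ι w y = S.ι (w + Pi.single i z) y := by
  rw [uEl, mul_smul]
  rcases le_total 0 z with hz | hz
  · have : (-z).toNat = 0 := by omega
    rw [this, pow_zero, one_smul, S.hu_pos _ _ _ _ h, Int.toNat_of_nonneg hz]
  · have : z.toNat = 0 := by omega
    rw [this, pow_zero, one_smul, S.hu_neg, Int.toNat_of_nonneg (by omega), Pi.single_neg, sub_neg_eq_add]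

lemma hv (z w y) (h : ∀ i ∈ D, 0 < w i) : vEl K z • S.ι w y = S.ι (w + z) y := by
  classical
  have key : ∀ l : List (Fin n), l.Nodup →
      (l.map fun i => uEl K i (z i)).prod • S.ι w y = S.ι (w + fun i => if i ∈ l then z i else 0) y := by
    intro l
    induction l with
    | nil => intro _; simp only [List.map_nil, List.prod_nil, one_smul, List.not_mem_nil, if_false]; congr 2; ext; simp
    | cons a l ih =>
      intro hl
      rw [List.nodup_cons] at hl
      rw [List.map_cons, List.prod_cons, mul_smul, ih hl.2, S.hu]
      · congr 2
        ext j
        by_cases hj : j = a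
        · subst hj; simp [hl.1]
        · simp [hj]
      · intro ha
        simp [hl.1, h a ha]
  rw [vEl, key _ (List.nodup_finRange n)]
  congr 2; ext; simp

section Acts

/-- `a` acts on the basis vectors by the polynomial shift operator coded by `L`. -/
def Acts (D0 : Set (Fin n)) (a : In K n) (M : ℕ) (w0 : Fin n → ℤ)
    (L : List ((Fin n → ℤ) × MvPolynomial (Fin n) K)) : Prop :=
  ∀ w, (∀ i ∈ D0, w i = w0 i) → (∀ i ∈ D, i ∉ D0 → (M : ℤ) < w i) → ∀ y,
    a • S.ι w y = (L.map fun e => S.ι (w + e.1) (MvPolynomial.aeval (wt lam t w) e.2 • y)).sum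

omit [CharZero K] in
def _root_.IDO.Bd (M : ℕ) (L : List ((Fin n → ℤ) × MvPolynomial (Fin n) K)) : Prop :=
  ∀ e ∈ L, ∀ i, -(M : ℤ) ≤ e.1 i

variable {S} {D0 : Set (Fin n)} {a b : In K n} {M M' : ℕ} {w0 : Fin n → ℤ}
  {L L' : List ((Fin n → ℤ) × MvPolynomial (Fin n) K)}

lemma Acts.mono (h : S.Acts D0 a M w0 L) (hM : M ≤ M') : S.Acts D0 a M' w0 L :=
  fun w h1 h2 y => h w h1 (fun i hi hi' => lt_of_le_of_lt (by exact_mod_cast hM) (h2 i hi hi')) y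

lemma _root_.IDO.Bd.mono (h : Bd M L) (hM : M ≤ M') : Bd M' L :=
  fun e he i => le_trans (by simpa using hM) (h e he i)

lemma acts_one : S.Acts D0 1 0 w0 [(0, 1)] := fun w _ _ y => by simp

lemma Acts.add (h : S.Acts D0 a M w0 L) (h' : S.Acts D0 b M w0 L') : S.Acts D0 (a + b) M w0 (L ++ L') :=
  fun w h1 h2 y => by
    rw [add_smul, h w h1 h2 y, h' w h1 h2 y]; simp

lemma Acts.smul (c : K) (h : S.Acts D0 a M w0 L) :
    S.Acts D0 (c • a) M w0 (L.map fun e => (e.1, MvPolynomial.C c * e.2)) :=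
  fun w h1 h2 y => by
    rw [smul_assoc, h w h1 h2 y, List.smul_sum, List.map_map, List.map_map]
    congr 1
    refine List.map_congr_left fun e _ => ?_
    simp [mul_smul]

lemma Acts.d (i : Fin n) (h : S.Acts D0 a M w0 L) :
    S.Acts D0 (dEl K n i * a) M w0 (L.map fun e => (e.1 - Pi.single i 1, e.2)) :=
  fun w h1 h2 y => by
    rw [mul_smul, h w h1 h2 y, List.smul_sum, List.map_map, List.map_map]
    congr 1
    refine List.map_congr_left fun e _ => ?_
    simp only [Function.comp]
    rw [S.hd, add_sub_assoc]

lemma Acts.x (i : Fin n) (h : S.Acts D0 a M w0 L) :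
    S.Acts D0 (xEl K n i * a) M w0 (L.map fun e => (e.1 + Pi.single i 1,
      (MvPolynomial.X i + MvPolynomial.C (e.1 i : K)) * e.2)) :=
  fun w h1 h2 y => by
    rw [mul_smul, h w h1 h2 y, List.smul_sum, List.map_map, List.map_map]
    congr 1
    refine List.map_congr_left fun e _ => ?_
    simp only [Function.comp]
    rw [S.hx', add_assoc, smul_smul, map_mul]
    congr 3
    simp [wt]; ring

open Classical in
lemma Acts.int (i : Fin n) (hD : D0 ⊆ D) (hb : Bd M L) (h : S.Acts D0 a M w0 L) :
    S.Acts D0 (intEl K n i * a) M w0 (L.map fun e => (e.1 + Pi.single i 1,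
      if i ∈ D0 → 0 < w0 i + e.1 i then e.2 else 0)) :=
  fun w h1 h2 y => by
    rw [mul_smul, h w h1 h2 y, List.smul_sum, List.map_map, List.map_map]
    congr 1
    refine List.map_congr_left fun e he => ?_
    simp only [Function.comp]
    split_ifs with hc
    · rw [S.hint, add_assoc]
      intro hi
      by_cases hi0 : i ∈ D0
      · rw [Pi.add_apply, h1 i hi0]; exact hc hi0
      · have := h2 i hi hi0
        have := hb e he i
        simp; omega
    · push Not at hc
      rw [S.hint0 i _ _ (hD hc.1)]
      · simp
      · rw [Pi.add_apply, h1 i hc.1]; exact hc.2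

end Acts

/-- Uniform polynomial description of the action of an element of `𝕀_n`. -/
lemma exists_acts {D' : Set (Fin n)} {lam' : Fin n → K}
    {A' : Type*} [CommRing A'] [Algebra K A'] {t' : Fin n → A'}
    {N' : Type*} [AddCommGroup N'] [Module K N'] [Module A' N'] [IsScalarTower K A' N']
    {V' : Type*} [AddCommGroup V'] [Module K V'] [Module (In K n) V']
    [IsScalarTower K (In K n) V'] (S' : Std D' lam' t' N' V') (D0 : Set (Fin n))
    (hD : D0 ⊆ D) (hD' : D0 ⊆ D') (a : In K n) :
    ∃ M : ℕ, ∀ w0, ∃ L, Bd M L ∧ S.Acts D0 a M w0 L ∧ S'.Acts D0 a M w0 L := by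
  classical
  induction a using In_induction with
  | one => exact ⟨0, fun w0 => ⟨_, by simp [Bd], acts_one, acts_one⟩⟩
  | add a b ha hb =>
    obtain ⟨M, ha⟩ := ha
    obtain ⟨M', hb⟩ := hb
    refine ⟨M ⊔ M', fun w0 => ?_⟩
    obtain ⟨L, h1, h2, h3⟩ := ha w0
    obtain ⟨L', h1', h2', h3'⟩ := hb w0
    refine ⟨L ++ L', ?_, (h2.mono le_sup_left).add (h2'.mono le_sup_right), (h3.mono le_sup_left).add (h3'.mono le_sup_right)⟩
    intro e he
    rcases List.mem_append.1 he with he | he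
    · exact h1.mono le_sup_left e he
    · exact h1'.mono le_sup_right e he
  | smul c a ha =>
    obtain ⟨M, ha⟩ := ha
    refine ⟨M, fun w0 => ?_⟩
    obtain ⟨L, h1, h2, h3⟩ := ha w0
    refine ⟨_, ?_, h2.smul c, h3.smul c⟩
    intro e he
    obtain ⟨e', he', rfl⟩ := List.mem_map.1 he
    exact h1 e' he'
  | hx i a ha =>
    obtain ⟨M, ha⟩ := ha
    refine ⟨M, fun w0 => ?_⟩
    obtain ⟨L, h1, h2, h3⟩ := ha w0
    refine ⟨_, ?_, h2.x i, h3.x i⟩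
    intro e he j
    obtain ⟨e', he', rfl⟩ := List.mem_map.1 he
    have := h1 e' he' j
    simp only [Pi.add_apply]
    have : (0 : ℤ) ≤ (Pi.single i 1 : Fin n → ℤ) j := by
      by_cases hj : j = i
      · subst hj; simp
      · simp [hj]
    omega
  | hd i a ha =>
    obtain ⟨M, ha⟩ := ha
    refine ⟨M + 1, fun w0 => ?_⟩
    obtain ⟨L, h1, h2, h3⟩ := ha w0
    refine ⟨_, ?_, (h2.d i).mono (Nat.le_succ _), (h3.d i).mono (Nat.le_succ _)⟩
    intro e he j
    obtain ⟨e', he', rfl⟩ := List.mem_map.1 he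
    have := h1 e' he' j
    simp only [Pi.sub_apply]
    have : (Pi.single i 1 : Fin n → ℤ) j ≤ 1 := by
      by_cases hj : j = i
      · subst hj; simp
      · simp [hj]
    push_cast; omega
  | hint i a ha =>
    obtain ⟨M, ha⟩ := ha
    refine ⟨M, fun w0 => ?_⟩
    obtain ⟨L, h1, h2, h3⟩ := ha w0
    refine ⟨_, ?_, h2.int i hD h1, h3.int i hD' h1⟩
    intro e he j
    obtain ⟨e', he', rfl⟩ := List.mem_map.1 he
    have := h1 e' he' j
    simp only [Pi.add_apply]
    have : (0 : ℤ) ≤ (Pi.single i 1 : Fin n → ℤ) j := by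
      by_cases hj : j = i
      · subst hj; simp
      · simp [hj]
    omega

end Std

section kill
variable {K : Type*} [Field K] [CharZero K] {n : ℕ}

lemma eElN_mem (i : Fin n) (E : Set (Fin n)) (hi : i ∈ E) (s r) : eElN K n i s r ∈ aIdeal K n E := by
  have h1 : pIdeal K n i ≤ aIdeal K n E := le_iSup₂_of_le i hi le_rfl
  exact h1 (TwoSidedIdeal.subset_span ⟨s, r, rfl⟩)

variable (K) in
def qEl (M : ℕ) (i : Fin n) : In K n := intEl K n i ^ M * dEl K n i ^ M

lemma one_sub_q (M : ℕ) (i : Fin n) : 1 - qEl K M i = ∑ s ∈ Finset.range M, eElN K n i s s := by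
  unfold eElN qEl
  rw [Finset.sum_range_sub']
  simp

open Classical in
lemma q_act (M : ℕ) (i : Fin n) (w : Fin n → ℤ) (y : K) :
    qEl K M i • (stdP (K := K)).ι w y = if (M : ℤ) < w i then stdP.ι w y else 0 := by
  rw [qEl, mul_smul, stdP.hu_neg]
  split_ifs with h
  · rw [stdP.hu_pos, sub_add_cancel]
    intro _; simpa using h
  · rw [stdP.zero _ i trivial (by simpa using h)]; simp

/-- ordered product of the `q_i` over a list -/
lemma exists_R (M : ℕ) (E : Set (Fin n)) : ∃ R : In K n, 1 - R ∈ aIdeal K n E ∧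
    (∀ w y, (∀ i ∈ E, (M : ℤ) < w i) → R • stdP.ι w (y : K) = stdP.ι w y) ∧
    (∀ w y, (¬ ∀ i ∈ E, (M : ℤ) < w i) → R • stdP.ι w (y : K) = 0) := by
  classical
  have key : ∀ l : List (Fin n), (∀ i ∈ l, i ∈ E) → ∃ R : In K n, 1 - R ∈ aIdeal K n E ∧
    (∀ w y, (∀ i ∈ l, (M : ℤ) < w i) → R • stdP.ι w (y : K) = stdP.ι w y) ∧
    (∀ w y, (¬ ∀ i ∈ l, (M : ℤ) < w i) → R • stdP.ι w (y : K) = 0) := by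
    intro l
    induction l with
    | nil => intro _; exact ⟨1, by simp, by simp, by simp⟩
    | cons i l ih =>
      intro hl
      obtain ⟨R, h1, h2, h3⟩ := ih fun j hj => hl j (by simp [hj])
      refine ⟨qEl K M i * R, ?_, ?_, ?_⟩
      · have e : 1 - qEl K M i * R = (1 - qEl K M i) * R + (1 - R) := by noncomm_ring
        rw [e]
        refine add_mem (TwoSidedIdeal.mul_mem_right _ _ _ ?_) h1
        rw [one_sub_q]
        exact sum_mem fun s _ => eElN_mem i E (hl i (by simp)) s s
      · intro w y hw
        rw [mul_smul, h2 w y fun j hj => hw j (by simp [hj]), q_act, if_pos (hw i (by simp))]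
      · intro w y hw
        rw [mul_smul]
        by_cases h : ∀ j ∈ l, (M : ℤ) < w j
        · rw [h2 w y h, q_act, if_neg]
          intro hi
          exact hw (by simpa [hi] using h)
        · rw [h3 w y h, smul_zero]
  obtain ⟨R, h1, h2, h3⟩ := key ((List.finRange n).filter (· ∈ E)) (by simp)
  exact ⟨R, h1, fun w y h => h2 w y (by simpa using h), fun w y h => h3 w y (by simpa using h)⟩

lemma mem_aIdeal_of_kills (E : Set (Fin n)) (a : In K n) (M : ℕ)
    (h : ∀ w : Fin n → ℤ, (∀ i, 0 < w i) → (∀ i ∈ E, (M : ℤ) < w i) → a • stdP.ι w (1 : K) = 0) :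
    a ∈ aIdeal K n E := by
  obtain ⟨R, h1, h2, h3⟩ := exists_R (K := K) M E
  have e : a * R = 0 := by
    apply In_ext2
    intro p
    rw [zero_smul]
    induction p using (stdP (K := K) (n := n)).ind with
    | h0 => simp
    | hι w hw y =>
      rw [mul_smul]
      by_cases hh : ∀ i ∈ E, (M : ℤ) < w i
      · rw [h2 w y hh]
        have := h w (fun i => hw i trivial) hh
        rw [show y = y • (1 : K) by simp, map_smul, ← smul_comm, this, smul_zero]
      · rw [h3 w y hh, smul_zero]
    | hadd u v hu hv => rw [smul_add, hu, hv, add_zero]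
  have : a = a * (1 - R) := by rw [mul_sub, e]; simp
  rw [this]
  exact TwoSidedIdeal.mul_mem_left _ _ _ h1

lemma kills_of_mem_aFull (a : In K n) (ha : a ∈ aFull K n) :
    ∃ M : ℕ, ∀ w : Fin n → ℤ, (∀ i, (M : ℤ) < w i) → ∀ y : K, a • stdP.ι w y = 0 := by
  let J : TwoSidedIdeal (In K n) := TwoSidedIdeal.mk'
    {a | ∃ M : ℕ, ∀ w : Fin n → ℤ, (∀ i, (M : ℤ) < w i) → ∀ y : K, a • stdP.ι w y = 0}
    ⟨0, by simp⟩
    (by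
      rintro a b ⟨M, ha⟩ ⟨M', hb⟩
      refine ⟨M ⊔ M', fun w hw y => ?_⟩
      rw [add_smul, ha w fun i => ?_, hb w fun i => ?_, add_zero]
      · exact lt_of_le_of_lt (by exact_mod_cast le_sup_right) (hw i)
      · exact lt_of_le_of_lt (by exact_mod_cast le_sup_left) (hw i))
    (by
      rintro a ⟨M, ha⟩
      exact ⟨M, fun w hw y => by rw [neg_smul, ha w hw, neg_zero]⟩)
    (by
      rintro a b ⟨M, ha⟩
      exact ⟨M, fun w hw y => by rw [mul_smul, ha w hw, smul_zero]⟩)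
    (by
      rintro a b ⟨M, ha⟩
      obtain ⟨M', hb⟩ := (stdP (K := K) (n := n)).exists_acts stdP ∅ (by simp) (by simp) b
      obtain ⟨L, h1, h2, -⟩ := hb 0
      refine ⟨M + M', fun w hw y => ?_⟩
      rw [mul_smul, h2 w (by simp) fun i _ _ => ?_, List.smul_sum]
      · apply List.sum_eq_zero
        intro v hv
        simp only [List.map_map, List.mem_map] at hv
        obtain ⟨e, he, rfl⟩ := hv
        apply ha
        intro i
        have := h1 e he i
        have := hw i
        push_cast at this
        simp; omega
      · have := hw i
        push_cast at this
        omega)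
  have h : aFull K n ≤ J := by
    refine iSup₂_le fun i _ => TwoSidedIdeal.span_le.2 ?_
    rintro _ ⟨s, r, rfl⟩
    rw [SetLike.mem_coe, TwoSidedIdeal.mem_mk']
    refine ⟨r + 1, fun w hw y => ?_⟩
    have h1 := hw i
    push_cast at h1
    rw [eElN, sub_smul, mul_smul, mul_smul, stdP.hu_neg, stdP.hu_neg, stdP.hu_pos, stdP.hu_pos, sub_eq_zero]
    · congr 2
      rw [sub_add, sub_add, ← Pi.single_sub, ← Pi.single_sub]
      push_cast; congr 2; ring
    · intro _; simp; omega
    · intro _; simp; omega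
  have h2 := h ha
  rw [TwoSidedIdeal.mem_mk'] at h2
  exact h2

end kill

end StdSec2

noncomputable section StdSec3

namespace Std

variable {K : Type*} [Field K] [CharZero K] {n : ℕ} {D : Set (Fin n)} {lam : Fin n → K}
    {A : Type*} [CommRing A] [Algebra K A] {t : Fin n → A}
    {N : Type*} [AddCommGroup N] [Module K N] [Module A N] [IsScalarTower K A N]
    {V : Type*} [AddCommGroup V] [Module K V] [Module (In K n) V]
    [IsScalarTower K (In K n) V] (S : Std D lam t N V)

lemma π_zero (w) (h : ¬ ∀ i ∈ D, 0 < w i) (v : V) : S.π w v = 0 := by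
  induction v using S.ind with
  | h0 => simp
  | hι w' hw' y =>
    apply S.π_ne
    rintro rfl; exact h hw'
  | hadd u v hu hv => rw [map_add, hu, hv, add_zero]

lemma gAct (i : Fin n) (c : K) (k : ℕ) (w y) :
    (HEl K n i - algebraMap K (In K n) c) ^ k • S.ι w y
      = S.ι w ((wt lam t w i - algebraMap K A c) ^ k • y) := by
  induction k generalizing y with
  | zero => simp
  | succ k ih =>
    rw [pow_succ, mul_smul, sub_smul, S.hH, algebraMap_smul, ← map_smul, ← map_sub, ih, pow_succ,
      mul_smul, sub_smul, algebraMap_smul]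

lemma π_gAct (i : Fin n) (c : K) (k : ℕ) (w v) :
    S.π w ((HEl K n i - algebraMap K (In K n) c) ^ k • v)
      = (wt lam t w i - algebraMap K A c) ^ k • S.π w v := by
  induction v using S.ind with
  | h0 => simp
  | hι w' hw' y =>
    rw [S.gAct]
    by_cases h : w = w'
    · subst h; rw [S.π_same w hw', S.π_same w hw']
    · rw [S.π_ne _ _ h, S.π_ne _ _ h, smul_zero]
  | hadd u v hu hv => rw [smul_add, map_add, hu, hv, map_add, smul_add]

omit [CharZero K] in
lemma wt_sub (w : Fin n → ℤ) (i) (c : K) : wt lam t w i - algebraMap K A c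
    = algebraMap K A (lam i + w i - c) + t i := by
  rw [wt, map_sub]; ring

omit [CharZero K] in
lemma isUnit_add (ht : ∀ i, IsNilpotent (t i)) (c : K) (hc : c ≠ 0) (i) :
    IsUnit (algebraMap K A c + t i) := by
  apply IsNilpotent.isUnit_add_left_of_commute (ht i) _ (Commute.all _ _)
  exact (isUnit_iff_ne_zero.2 hc).map _

lemma mem_gws (ht : ∀ i, IsNilpotent (t i)) (mu : Fin n → K) (v : V) :
    v ∈ genWeightSpace K n V mu ↔ ∀ w, S.π w v ≠ 0 → ∀ i, lam i + (w i : K) = mu i := by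
  constructor
  · rintro ⟨k, hk⟩ w hw i
    by_contra hne
    have := congrArg (S.π w) (hk i)
    rw [S.π_gAct, wt_sub, map_zero] at this
    have hu := (isUnit_add ht _ (sub_ne_zero.2 hne) i).pow k
    exact hw ((IsUnit.smul_eq_zero hu).1 this)
  · intro h
    choose k hk using ht
    refine ⟨∑ i, k i, fun i => S.eq_zero _ fun w => ?_⟩
    rw [S.π_gAct, wt_sub]
    by_cases hw : S.π w v = 0
    · rw [hw, smul_zero]
    · rw [h w hw i, sub_self, map_zero, zero_add]
      rw [pow_eq_zero_of_le (Finset.single_le_sum (fun _ _ => Nat.zero_le _) (Finset.mem_univ i)) (hk i), zero_smul]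

lemma ι_mem (ht : ∀ i, IsNilpotent (t i)) (w y) :
    S.ι w y ∈ genWeightSpace K n V (fun i => lam i + (w i : K)) := by
  rw [S.mem_gws ht]
  intro w' hw' i
  by_cases h : w' = w
  · rw [h]
  · exact absurd (S.π_ne _ _ h y) hw'

omit S in
lemma wt_inj {w w' : Fin n → ℤ} (h : ∀ i, lam i + (w i : K) = lam i + (w' i : K)) : w = w' := by
  ext i
  exact_mod_cast add_left_cancel (h i)

include S in
lemma isGenWeight (ht : ∀ i, IsNilpotent (t i)) : IsGenWeightModule K n V := by
  unfold IsGenWeightModule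
  letI := Classical.decEq (Fin n → K)
  refine (DirectSum.isInternal_submodule_iff_iSupIndep_and_iSup_eq_top _).2 ⟨?_, ?_⟩
  · intro mu
    rw [Submodule.disjoint_def]
    intro v h1 h2
    apply S.eq_zero
    intro w
    by_contra hw
    have h3 := (S.mem_gws ht mu v).1 h1 w hw
    have : (⨆ j, ⨆ (_ : j ≠ mu), genWeightSpace K n V j) ≤ LinearMap.ker (S.π w) := by
      refine iSup₂_le fun nu hnu u hu => ?_
      rw [LinearMap.mem_ker]
      by_contra hu'
      exact hnu (funext fun i => by rw [← h3 i, (S.mem_gws ht nu u).1 hu w hu' i])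
    exact hw (this h2)
  · rw [eq_top_iff]
    intro v _
    induction v using S.ind with
    | h0 => exact zero_mem _
    | hι w hw y => exact Submodule.mem_iSup_of_mem _ (S.ι_mem ht w y)
    | hadd u v hu hv => exact add_mem (hu trivial) (hv trivial)

include S in
lemma mem_supp (ht : ∀ i, IsNilpotent (t i)) [Nontrivial N] (mu : Fin n → K) :
    mu ∈ supp K n V ↔ ∃ w : Fin n → ℤ, (∀ i ∈ D, 0 < w i) ∧ mu = fun i => lam i + (w i : K) := by
  constructor
  · intro h
    obtain ⟨v, hv, hv0⟩ := Submodule.exists_mem_ne_zero_of_ne_bot h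
    obtain ⟨w, hw⟩ : ∃ w, S.π w v ≠ 0 := by
      by_contra h'
      push Not at h'
      exact hv0 (S.eq_zero v h')
    refine ⟨w, ?_, ?_⟩
    · by_contra h'
      exact hw (S.π_zero w h' v)
    · exact funext fun i => ((S.mem_gws ht mu v).1 hv w hw i).symm
  · rintro ⟨w, hw, rfl⟩ h0
    obtain ⟨y, hy⟩ := exists_ne (0 : N)
    have := S.ι_mem ht w y
    rw [h0, Submodule.mem_bot] at this
    apply hy
    rw [← S.π_same w hw y, this, map_zero]

include S in
lemma supp_eq (ht : ∀ i, IsNilpotent (t i)) [Nontrivial N] : supp K n V = SuppMD K n lam D := by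
  ext mu
  rw [S.mem_supp ht]
  constructor
  · rintro ⟨w, hw, rfl⟩
    refine ⟨fun i hi => ⟨(w i).toNat, ?_, ?_⟩, fun i _ => ⟨w i, rfl⟩⟩
    · have := hw i hi; omega
    · have := hw i hi
      show lam i + (w i : K) = _
      rw [S.lam0 i hi, zero_add]
      have : ((w i).toNat : ℤ) = w i := Int.toNat_of_nonneg this.le
      exact_mod_cast congrArg (Int.cast : ℤ → K) this.symm
  · rintro ⟨h1, h2⟩
    have : ∀ i, ∃ z : ℤ, (i ∈ D → 0 < z) ∧ mu i = lam i + (z : K) := by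
      intro i
      by_cases hi : i ∈ D
      · obtain ⟨m, hm, h⟩ := h1 i hi
        exact ⟨m, fun _ => by exact_mod_cast hm, by rw [S.lam0 i hi, h]; simp⟩
      · obtain ⟨z, hz⟩ := h2 i hi
        exact ⟨z, fun h => absurd h hi, hz⟩
    choose w hw1 hw2 using this
    exact ⟨w, hw1, funext hw2⟩

include S in
lemma finrank_gws (ht : ∀ i, IsNilpotent (t i)) (w : Fin n → ℤ) (hw : ∀ i ∈ D, 0 < w i) :
    Module.finrank K (genWeightSpace K n V (fun i => lam i + (w i : K))) = Module.finrank K N := by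
  symm
  refine LinearEquiv.finrank_eq (LinearEquiv.ofBijective
    (LinearMap.codRestrict (genWeightSpace K n V (fun i => lam i + (w i : K))) (S.ι w) (S.ι_mem ht w)) ⟨?_, ?_⟩)
  · intro y y' h
    have := congrArg (fun v => S.π w v.1) h
    simpa [S.π_same w hw] using this
  · rintro ⟨v, hv⟩
    refine ⟨S.π w v, Subtype.ext ?_⟩
    show S.ι w (S.π w v) = v
    rw [S.mem_gws ht] at hv
    obtain ⟨s, hs⟩ := S.decomp v
    classical
    conv_rhs => rw [hs (insert w s) (Finset.subset_insert _ _)]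
    rw [Finset.sum_eq_single w]
    · intro b _ hb
      by_cases h : S.π b v = 0
      · rw [h, map_zero]
      · exact absurd (wt_inj (hv b h)) hb
    · intro h; simp at h

section lattice

variable (hgen : Algebra.adjoin K (Set.range t) = ⊤)
include hgen

/-- The `A`-submodule of `N` attached to a submodule of `V` -/
def toN (w : Fin n → ℤ) (p : Submodule (In K n) V) : Submodule A N where
  carrier := {y | S.ι w y ∈ p}
  add_mem' := by intro a b ha hb; simp only [Set.mem_ofPred_eq, map_add] at *; exact add_mem ha hb
  zero_mem' := by simp
  smul_mem' := by
    intro a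
    have ha : a ∈ Algebra.adjoin K (Set.range t) := by rw [hgen]; trivial
    have hK : ∀ (c : K) (v : V), v ∈ p → c • v ∈ p := fun c v hv => by
      rw [← algebraMap_smul (In K n) c v]; exact p.smul_mem _ hv
    induction ha using Algebra.adjoin_induction with
    | mem x hx =>
      obtain ⟨i, rfl⟩ := hx
      intro y hy
      have := S.gAct i (lam i + w i) 1 w y
      rw [wt_sub, sub_self, map_zero, zero_add, pow_one, pow_one] at this
      show S.ι w (t i • y) ∈ p
      rw [← this]
      exact p.smul_mem _ hy
    | algebraMap c =>
      intro y hy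
      show S.ι w (algebraMap K A c • y) ∈ p
      rw [algebraMap_smul, map_smul]
      exact hK _ _ hy
    | add a b _ _ ha hb =>
      intro y hy
      show S.ι w ((a + b) • y) ∈ p
      rw [add_smul, map_add]
      exact add_mem (ha hy) (hb hy)
    | mul a b _ _ ha hb =>
      intro y hy
      rw [mul_smul]
      exact ha (hb hy)

lemma mem_toN (w p y) : y ∈ S.toN hgen w p ↔ S.ι w y ∈ p := Iff.rfl

omit hgen in
lemma transfer (p : Submodule (In K n) V) {w w'} (hw : ∀ i ∈ D, 0 < w i) (y)
    (h : S.ι w y ∈ p) : S.ι w' y ∈ p := by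
  have := S.hv (w' - w) w y hw
  rw [add_sub_cancel] at this
  rw [← this]; exact p.smul_mem _ h

lemma proj_mem (ht : ∀ i, IsNilpotent (t i)) (p : Submodule (In K n) V) (v) (hv : v ∈ p) (w) :
    S.ι w (S.π w v) ∈ p := by
  classical
  have key : ∀ s : Finset (Fin n → ℤ), w ∉ s → ∀ (y0 : N) (y : (Fin n → ℤ) → N),
      S.ι w y0 + ∑ w' ∈ s, S.ι w' (y w') ∈ p → S.ι w y0 ∈ p := by
    intro s
    induction s using Finset.induction_on with
    | empty => intro _ y0 y h; simpa using h
    | insert w1 s h1 ih =>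
      intro hw y0 y h
      rw [Finset.mem_insert, not_or] at hw
      obtain ⟨i, hi⟩ := Function.ne_iff.1 hw.1
      obtain ⟨k, hk⟩ := ht i
      have h2 := p.smul_mem ((HEl K n i - algebraMap K (In K n) (lam i + w1 i)) ^ k) h
      rw [Finset.sum_insert h1, smul_add, smul_add, S.gAct, S.gAct, Finset.smul_sum] at h2
      simp only [S.gAct] at h2
      rw [wt_sub w1, sub_self, map_zero, zero_add, hk, zero_smul, map_zero, zero_add] at h2
      have h3 := ih hw.2 _ _ h2
      rw [wt_sub] at h3
      have hu := (isUnit_add ht (lam i + w i - (lam i + w1 i)) (by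
        rw [add_sub_add_left_eq_sub, sub_ne_zero]; exact_mod_cast hi) i).pow k
      obtain ⟨u, hu⟩ := hu
      rw [← hu] at h3
      have h4 := (S.toN hgen w p).smul_mem (↑u⁻¹ : A) ((S.mem_toN hgen w p _).2 h3)
      rwa [smul_smul, Units.inv_mul, one_smul, S.mem_toN] at h4
  obtain ⟨s, hs⟩ := S.decomp v
  refine key (s.erase w) (by simp) _ (fun w' => S.π w' v) ?_
  have := hs (insert w (s.erase w)) (by
    intro x hx
    by_cases h : x = w <;> simp [h, hx])
  rw [Finset.sum_insert (by simp)] at this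
  rwa [← this]

omit hgen in
/-- The submodule of `V` attached to an `A`-submodule of `N` -/
def toV (q : Submodule A N) : Submodule (In K n) V where
  carrier := {v | ∀ w, S.π w v ∈ q}
  add_mem' := by intro a b ha hb w; rw [map_add]; exact add_mem (ha w) (hb w)
  zero_mem' := by intro w; simp
  smul_mem' := by
    have hK : ∀ (c : K) (y : N), y ∈ q → c • y ∈ q := fun c y hy => by
      rw [← algebraMap_smul A c y]; exact q.smul_mem _ hy
    have hι : ∀ w w' y, y ∈ q → S.π w (S.ι w' y) ∈ q := by
      intro w w' y hy
      by_cases h : w = w'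
      · subst h
        by_cases hw : ∀ i ∈ D, 0 < w i
        · rwa [S.π_same w hw]
        · rw [S.π_zero w hw]; exact zero_mem _
      · rw [S.π_ne _ _ h]; exact zero_mem _
    have gen : ∀ g : In K n, (∀ w w' y, y ∈ q → S.π w (g • S.ι w' y) ∈ q) →
        ∀ v, (∀ w, S.π w v ∈ q) → ∀ w, S.π w (g • v) ∈ q := by
      intro g hg v hv w
      obtain ⟨s, hs⟩ := S.decomp v
      rw [hs s subset_rfl, Finset.smul_sum, map_sum]
      exact sum_mem fun w' _ => hg _ _ _ (hv w')
    intro a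
    induction a using In_induction with
    | one => intro v hv; simpa using hv
    | add a b ha hb => intro v hv w; rw [add_smul, map_add]; exact add_mem (ha hv w) (hb hv w)
    | smul c a ha => intro v hv w; rw [smul_assoc, map_smul]; exact hK _ _ (ha hv w)
    | hx i a ha =>
      intro v hv w
      rw [mul_smul]
      refine gen _ ?_ _ (ha hv) w
      intro w w' y hy
      rw [S.hx']
      exact hι _ _ _ (q.smul_mem _ hy)
    | hd i a ha =>
      intro v hv w
      rw [mul_smul]
      refine gen _ ?_ _ (ha hv) w
      intro w w' y hy
      rw [S.hd]
      exact hι _ _ _ hy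
    | hint i a ha =>
      intro v hv w
      rw [mul_smul]
      refine gen _ ?_ _ (ha hv) w
      intro w w' y hy
      by_cases h : i ∈ D → 0 < w' i
      · rw [S.hint _ _ _ h]
        exact hι _ _ _ hy
      · push Not at h
        rw [S.hint0 _ _ _ h.1 h.2, map_zero]; exact zero_mem _

lemma mem_iff (ht : ∀ i, IsNilpotent (t i)) (p : Submodule (In K n) V) {w0 : Fin n → ℤ}
    (hw0 : ∀ i ∈ D, 0 < w0 i) (v) :
    v ∈ p ↔ ∀ w, S.π w v ∈ S.toN hgen w0 p := by
  constructor
  · intro hv w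
    rw [S.mem_toN]
    by_cases hw : ∀ i ∈ D, 0 < w i
    · exact S.transfer p hw _ (S.proj_mem hgen ht p v hv w)
    · rw [S.π_zero w hw]; simp
  · intro h
    obtain ⟨s, hs⟩ := S.decomp v
    rw [hs s subset_rfl]
    exact sum_mem fun w _ => S.transfer p hw0 _ (h w)

/-- The lattice isomorphism. -/
def latIso (ht : ∀ i, IsNilpotent (t i)) (w0 : Fin n → ℤ) (hw0 : ∀ i ∈ D, 0 < w0 i) :
    Submodule (In K n) V ≃o Submodule A N :=
  Equiv.toOrderIso
    { toFun := S.toN hgen w0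
      invFun := S.toV
      left_inv := fun p => by
        ext v
        rw [S.mem_iff hgen ht p hw0]; rfl
      right_inv := fun q => by
        ext y
        rw [S.mem_toN]
        constructor
        · intro h
          have := h w0
          rwa [S.π_same w0 hw0] at this
        · intro hy w
          by_cases h : w = w0
          · subst h; rwa [S.π_same w hw0]
          · rw [S.π_ne _ _ h]; exact zero_mem _ }
    (fun p p' h y hy => h hy) (fun q q' h v hv w => h (hv w))

end lattice

end Std

section cov

variable {K : Type*} [Field K] {n : ℕ}
    {A : Type*} [CommRing A] [Algebra K A] {t : Fin n → A}
    {N : Type*} [AddCommGroup N] [Module K N] [Module A N] [IsScalarTower K A N]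
    (hgen : Algebra.adjoin K (Set.range t) = ⊤) (ht : ∀ i, IsNilpotent (t i))

include ht in
lemma cov_t {p q : Submodule A N} (h : p ⋖ q) (i : Fin n) (y : N) (hy : y ∈ q) : t i • y ∈ p := by
  let r : Submodule A N := p ⊔ q.map (LinearMap.lsmul A N (t i))
  have h1 : p ≤ r := le_sup_left
  have h2 : r ≤ q := sup_le h.le (by rintro _ ⟨y, hy, rfl⟩; exact q.smul_mem _ hy)
  have h3 : t i • y ∈ r := Submodule.mem_sup_right ⟨y, hy, rfl⟩
  rcases h.eq_or_eq h1 h2 with h4 | h4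
  · rwa [h4] at h3
  · exfalso
    have key : ∀ k : ℕ, ∀ y ∈ q, ∃ y' ∈ q, y - t i ^ k • y' ∈ p := by
      intro k
      induction k with
      | zero => intro y hy; exact ⟨y, hy, by simp⟩
      | succ k ih =>
        intro y hy
        rw [← h4] at hy
        obtain ⟨a, ha, _, ⟨b, hb, rfl⟩, rfl⟩ := Submodule.mem_sup.1 hy
        obtain ⟨y', hy', h5⟩ := ih b hb
        refine ⟨y', hy', ?_⟩
        have : a + (LinearMap.lsmul A N (t i)) b - t i ^ (k + 1) • y' = a + t i • (b - t i ^ k • y') := by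
          rw [LinearMap.lsmul_apply, smul_sub, smul_smul, pow_succ']; abel
        rw [this]
        exact add_mem ha (p.smul_mem _ h5)
    obtain ⟨k, hk⟩ := ht i
    refine h.lt.not_ge fun y hy => ?_
    obtain ⟨y', _, h5⟩ := key k y hy
    simpa [hk] using h5

include hgen ht in
lemma cov_a {p q : Submodule A N} (h : p ⋖ q) (a : A) : ∃ c : K, ∀ y ∈ q, a • y - c • y ∈ p := by
  have ha : a ∈ Algebra.adjoin K (Set.range t) := by rw [hgen]; trivial
  induction ha using Algebra.adjoin_induction with
  | mem x hx =>
    obtain ⟨i, rfl⟩ := hx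
    exact ⟨0, fun y hy => by simpa using cov_t ht h i y hy⟩
  | algebraMap c => exact ⟨c, fun y hy => by simp⟩
  | add a b _ _ ha hb =>
    obtain ⟨c, hc⟩ := ha
    obtain ⟨d, hd⟩ := hb
    refine ⟨c + d, fun y hy => ?_⟩
    have : (a + b) • y - (c + d) • y = (a • y - c • y) + (b • y - d • y) := by
      rw [add_smul, add_smul]; abel
    rw [this]; exact add_mem (hc y hy) (hd y hy)
  | mul a b _ _ ha hb =>
    obtain ⟨c, hc⟩ := ha
    obtain ⟨d, hd⟩ := hb
    refine ⟨c * d, fun y hy => ?_⟩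
    have : (a * b) • y - (c * d) • y = a • (b • y - d • y) + (a • (d • y) - c • (d • y)) := by
      rw [mul_smul, mul_smul, smul_sub]; abel
    rw [this]
    refine add_mem (p.smul_mem _ (hd y hy)) (hc _ ?_)
    rw [← algebraMap_smul A d y]; exact q.smul_mem _ hy

include hgen ht in
lemma cov_gen {p q : Submodule A N} (h : p ⋖ q) : ∃ y ∈ q, y ∉ p ∧ ∀ y' ∈ q, ∃ c : K, y' - c • y ∈ p := by
  obtain ⟨y, hy, hyp⟩ := SetLike.exists_of_lt h.lt
  refine ⟨y, hy, hyp, ?_⟩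
  let r : Submodule A N := p ⊔ Submodule.span A {y}
  have h1 : p ≤ r := le_sup_left
  have h2 : r ≤ q := sup_le h.le (by rw [Submodule.span_le]; simpa using hy)
  have h3 : y ∈ r := Submodule.mem_sup_right (Submodule.mem_span_singleton_self y)
  rcases h.eq_or_eq h1 h2 with h4 | h4
  · rw [h4] at h3; exact absurd h3 hyp
  · intro y' hy'
    rw [← h4] at hy'
    obtain ⟨a, ha, b, hb, rfl⟩ := Submodule.mem_sup.1 hy'
    obtain ⟨x, rfl⟩ := Submodule.mem_span_singleton.1 hb
    obtain ⟨c, hc⟩ := cov_a hgen ht h x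
    refine ⟨c, ?_⟩
    rw [add_sub_assoc]
    exact add_mem ha (hc y hy)

include hgen ht in
lemma cov_finrank [FiniteDimensional K N] {p q : Submodule A N} (h : p ⋖ q) :
    Module.finrank K (q.restrictScalars K) = Module.finrank K (p.restrictScalars K) + 1 := by
  obtain ⟨y, hy, hyp, hq⟩ := cov_gen hgen ht h
  have e : q.restrictScalars K = p.restrictScalars K ⊔ Submodule.span K {y} := by
    apply le_antisymm
    · intro y' hy'
      obtain ⟨c, hc⟩ := hq y' hy'
      rw [Submodule.mem_sup]
      exact ⟨y' - c • y, hc, c • y, Submodule.smul_mem _ _ (Submodule.mem_span_singleton_self y), by abel⟩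
    · refine sup_le (fun x hx => h.le hx) ?_
      rw [Submodule.span_le]; simpa using hy
  have hd : p.restrictScalars K ⊓ Submodule.span K {y} = ⊥ := by
    rw [eq_bot_iff]
    rintro x ⟨hx, hx'⟩
    obtain ⟨c, rfl⟩ := Submodule.mem_span_singleton.1 hx'
    by_cases hc : c = 0
    · simp [hc]
    · exfalso
      apply hyp
      have := (p.restrictScalars K).smul_mem c⁻¹ hx
      rwa [smul_smul, inv_mul_cancel₀ hc, one_smul] at this
  have h5 := Submodule.finrank_sup_add_finrank_inf_eq (p.restrictScalars K) (Submodule.span K {y})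
  have hy0 : y ≠ 0 := by rintro rfl; exact hyp (zero_mem _)
  rw [hd, finrank_bot, add_zero, ← e, finrank_span_singleton hy0] at h5
  exact h5

include ht in
lemma exists_socle [FiniteDimensional K N] (q : Submodule A N) (hq : q ≠ ⊥) :
    ∃ y ∈ q, y ≠ 0 ∧ ∀ i, t i • y = 0 := by
  have : IsArtinian A N := isArtinian_of_tower K inferInstance
  obtain ⟨a, ha, haq⟩ := (eq_bot_or_exists_atom_le q).resolve_left hq
  obtain ⟨y, hy, hy0⟩ := Submodule.exists_mem_ne_zero_of_ne_bot ha.1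
  exact ⟨y, haq hy, hy0, fun i => by simpa using cov_t ht (bot_covBy_iff.2 ha) i y hy⟩

include hgen ht in
lemma exists_series [FiniteDimensional K N] {L : Type*} [Lattice L] [BoundedOrder L]
    [IsModularLattice L] [JordanHolderLattice L]
    (hJ : ∀ x y : L, JordanHolderLattice.IsMaximal x y ↔ x ⋖ y)
    (e : L ≃o Submodule A N) :
    ∃ s : CompositionSeries L, s.head = ⊥ ∧ s.last = ⊤ ∧ s.length = Module.finrank K N := by
  have : IsArtinian A N := isArtinian_of_tower K inferInstance
  have : IsNoetherian A N := isNoetherian_of_tower K inferInstance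
  obtain ⟨s, h1, h2⟩ := exists_compositionSeries_of_isNoetherian_isArtinian A N
  refine ⟨⟨s.length, fun i => e.symm (s i), fun i => ?_⟩, ?_, ?_, ?_⟩
  · exact (hJ _ _).2 ((apply_covBy_apply_iff e.symm).2 (s.step i))
  · show e.symm s.head = ⊥
    rw [h1, map_bot]
  · show e.symm s.last = ⊤
    rw [h2, map_top]
  · show s.length = _
    have key : ∀ i : ℕ, ∀ hi : i < s.length + 1,
        Module.finrank K ((s ⟨i, hi⟩).restrictScalars K) = i := by
      intro i
      induction i with
      | zero =>
        intro hi
        have : s ⟨0, hi⟩ = ⊥ := h1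
        rw [this, Submodule.restrictScalars_bot, finrank_bot]
      | succ i ih =>
        intro hi
        have h3 : s ⟨i, by omega⟩ ⋖ s ⟨i + 1, hi⟩ := s.step ⟨i, by omega⟩
        rw [cov_finrank hgen ht h3, ih]
    have h4 := key s.length (by omega)
    have h5 : s ⟨s.length, by omega⟩ = ⊤ := h2
    rw [h5, Submodule.restrictScalars_top, finrank_top] at h4
    exact h4.symm

include hgen ht in
lemma isLocal_A [Nontrivial A] : IsLocalRing A := by
  have hA : ∀ a : A, ∃ c : K, IsNilpotent (a - algebraMap K A c) := by
    intro a
    have ha : a ∈ Algebra.adjoin K (Set.range t) := by rw [hgen]; trivial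
    induction ha using Algebra.adjoin_induction with
    | mem x hx =>
      obtain ⟨i, rfl⟩ := hx
      exact ⟨0, by simpa using ht i⟩
    | algebraMap c => exact ⟨c, by simp⟩
    | add a b _ _ ha hb =>
      obtain ⟨c, hc⟩ := ha
      obtain ⟨d, hd⟩ := hb
      refine ⟨c + d, ?_⟩
      have : a + b - algebraMap K A (c + d) = (a - algebraMap K A c) + (b - algebraMap K A d) := by
        rw [map_add]; ring
      rw [this]; exact (Commute.all _ _).isNilpotent_add hc hd
    | mul a b _ _ ha hb =>
      obtain ⟨c, hc⟩ := ha
      obtain ⟨d, hd⟩ := hb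
      refine ⟨c * d, ?_⟩
      have : a * b - algebraMap K A (c * d) = a * (b - algebraMap K A d) + (a - algebraMap K A c) * algebraMap K A d := by
        rw [map_mul]; ring
      rw [this]
      exact (Commute.all _ _).isNilpotent_add ((Commute.all _ _).isNilpotent_mul_left hd) ((Commute.all _ _).isNilpotent_mul_right hc)
  apply IsLocalRing.of_isUnit_or_isUnit_one_sub_self
  intro a
  obtain ⟨c, hc⟩ := hA a
  by_cases h : c = 0
  · right
    subst h
    rw [map_zero, sub_zero] at hc
    exact hc.isUnit_one_sub
  · left
    have := IsNilpotent.isUnit_add_left_of_commute hc ((isUnit_iff_ne_zero.2 h).map (algebraMap K A)) (Commute.all _ _)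
    simpa using this

end cov

end StdSec3

noncomputable section StdSec4

open Classical in
def coef {K : Type*} [Field K] {n : ℕ} (L : List ((Fin n → ℤ) × MvPolynomial (Fin n) K))
    (z : Fin n → ℤ) : MvPolynomial (Fin n) K :=
  (L.map fun e => if e.1 = z then e.2 else 0).sum

/-- a polynomial vanishing on a translated lattice is zero -/
lemma poly_zero {K : Type*} [Field K] [CharZero K] {n : ℕ} (c : Fin n → K) (M : ℤ)
    (f : MvPolynomial (Fin n) K)
    (h : ∀ w : Fin n → ℤ, (∀ i, M < w i) → MvPolynomial.eval (fun i => c i + (w i : K)) f = 0) : f = 0 := by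
  refine MvPolynomial.funext_set (fun i => (fun z : ℤ => c i + (z : K)) '' Set.Ioi M) (fun i => ?_) ?_
  · apply (Set.Ioi_infinite M).image
    intro a _ b _ hab
    exact_mod_cast add_left_cancel hab
  · intro x hx
    have : ∀ i, ∃ z : ℤ, M < z ∧ c i + (z : K) = x i := fun i => hx i trivial
    choose w hw hw' using this
    rw [map_zero, ← h w hw]
    congr 2
    exact funext fun i => (hw' i).symm

namespace Std

variable {K : Type*} [Field K] [CharZero K] {n : ℕ} {D : Set (Fin n)} {lam : Fin n → K}
    {A : Type*} [CommRing A] [Algebra K A] {t : Fin n → A}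
    {N : Type*} [AddCommGroup N] [Module K N] [Module A N] [IsScalarTower K A N]
    {V : Type*} [AddCommGroup V] [Module K V] [Module (In K n) V]
    [IsScalarTower K (In K n) V] (S : Std D lam t N V)

lemma π_acts (L : List ((Fin n → ℤ) × MvPolynomial (Fin n) K)) (w z : Fin n → ℤ)
    (h : ∀ i ∈ D, 0 < w i + z i) (y : N) :
    S.π (w + z) ((L.map fun e => S.ι (w + e.1) (MvPolynomial.aeval (wt lam t w) e.2 • y)).sum)
      = MvPolynomial.aeval (wt lam t w) (coef L z) • y := by
  unfold coef
  induction L with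
  | nil => simp
  | cons e L ih =>
    simp only [List.map_cons, List.sum_cons, map_add, add_smul]
    rw [ih]
    congr 1
    split_ifs with he
    · rw [he, S.π_same _ (by simpa using h)]
    · rw [S.π_ne, map_zero, zero_smul]
      intro h'
      exact he (add_left_cancel h').symm

omit [CharZero K] in
lemma aeval_socle (y : N) (hy : ∀ i, t i • y = 0) (w) (f : MvPolynomial (Fin n) K) :
    MvPolynomial.aeval (wt lam t w) f • y = MvPolynomial.eval (fun i => lam i + (w i : K)) f • y := by
  induction f using MvPolynomial.induction_on with
  | C a => simp
  | add p q hp hq => rw [map_add, add_smul, hp, hq, map_add, add_smul]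
  | mul_X p i hp =>
    rw [map_mul, mul_smul, MvPolynomial.aeval_X, wt, add_smul, hy, add_zero, algebraMap_smul,
      smul_comm, hp, smul_smul, map_mul, MvPolynomial.eval_X, mul_comm]

lemma ann_strong (a : In K n) (y : N) (hy0 : y ≠ 0) (hy : ∀ i, t i • y = 0)
    (h : ∀ w, a • S.ι w y = 0) : a ∈ aIdeal K n Dᶜ := by
  classical
  obtain ⟨M, hM⟩ := S.exists_acts (stdP (K := K) (n := n)) D subset_rfl (fun _ _ => trivial) a
  refine mem_aIdeal_of_kills _ a M fun w hw hwM => ?_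
  obtain ⟨L, -, h1, h2⟩ := hM w
  have key : ∀ z, (∀ i ∈ D, 0 < w i + z i) →
      MvPolynomial.eval (fun i => (w i : K)) (coef L z) = 0 := by
    intro z hz
    have e1 : ∀ w' : Fin n → ℤ, (∀ i ∈ D, w' i = w i) →
        MvPolynomial.eval (fun i => lam i + (w' i : K)) (coef L z) = 0 := by
      intro w' hw'
      have := S.π_acts L w' z (fun i hi => by rw [hw' i hi]; exact hz i hi) y
      rw [← h1 w' hw' (fun i hi hi' => absurd hi hi') y, h, map_zero, aeval_socle y hy] at this
      exact (smul_eq_zero.1 this.symm).resolve_right hy0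
    let θ : Fin n → MvPolynomial (Fin n) K := fun i => if i ∈ D then MvPolynomial.C (w i : K) else MvPolynomial.X i
    have e2 : ∀ x : Fin n → K, MvPolynomial.eval x (MvPolynomial.bind₁ θ (coef L z))
        = MvPolynomial.eval (fun i => if i ∈ D then (w i : K) else x i) (coef L z) := by
      intro x
      have := MvPolynomial.eval₂Hom_bind₁ (RingHom.id K) x θ (coef L z)
      rw [show MvPolynomial.eval x = MvPolynomial.eval₂Hom (RingHom.id K) x from rfl, this]
      rw [show MvPolynomial.eval (fun i => if i ∈ D then (w i : K) else x i) = MvPolynomial.eval₂Hom (RingHom.id K) (fun i => if i ∈ D then (w i : K) else x i) from rfl]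
      congr 2
      funext i
      by_cases hi : i ∈ D <;> simp [θ, hi]
    have e3 : MvPolynomial.bind₁ θ (coef L z) = 0 := by
      apply poly_zero lam 0
      intro w' _
      rw [e2, ← e1 (fun i => if i ∈ D then w i else w' i) (fun i hi => by simp [hi])]
      congr 2
      funext i
      by_cases hi : i ∈ D <;> simp [hi, S.lam0]
    have e4 := e2 (fun i => (w i : K))
    rw [e3, map_zero] at e4
    simpa using e4.symm
  apply stdP.eq_zero
  intro u
  by_cases hu : ∀ i, 0 < u i
  · have e5 := (stdP (K := K) (n := n)).π_acts L w (u - w) (fun i _ => by simpa using hu i) 1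
    rw [← h2 w (fun _ _ => rfl) (fun i _ hi => hwM i hi), add_sub_cancel] at e5
    rw [e5, aeval_socle (1 : K) (by simp)]
    have e6 := key (u - w) (fun i _ => by simpa using hu i)
    simp only [Pi.zero_apply, zero_add]
    rw [e6, zero_smul]
  · apply stdP.π_zero
    intro h'
    exact hu fun i => h' i trivial

include S in
lemma aIdeal_le (a : In K n) (ha : a ∈ aIdeal K n Dᶜ) (v : V) : a • v = 0 := by
  let J : TwoSidedIdeal (In K n) := TwoSidedIdeal.mk' {a | ∀ v : V, a • v = 0}
    (by simp)
    (fun {a b} ha hb v => by rw [add_smul, ha, hb, add_zero])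
    (fun {a} ha v => by rw [neg_smul, ha, neg_zero])
    (fun {a b} hb v => by rw [mul_smul, hb, smul_zero])
    (fun {a b} ha v => by rw [mul_smul, ha])
  have h : aIdeal K n Dᶜ ≤ J := by
    refine iSup₂_le fun i hi => TwoSidedIdeal.span_le.2 ?_
    rintro _ ⟨s, r, rfl⟩
    rw [SetLike.mem_coe, TwoSidedIdeal.mem_mk']
    intro v
    induction v using S.ind with
    | h0 => simp
    | hι w hw y =>
      rw [eElN, sub_smul, mul_smul, mul_smul, S.hu_neg, S.hu_neg, S.hu_pos, S.hu_pos, sub_eq_zero]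
      · congr 2
        rw [sub_add, sub_add, ← Pi.single_sub, ← Pi.single_sub]
        push_cast; congr 2; ring
      · intro h; exact absurd h hi
      · intro h; exact absurd h hi
    | hadd u v hu hv => rw [smul_add, hu, hv, add_zero]
  have h2 := h ha
  rw [TwoSidedIdeal.mem_mk'] at h2
  exact h2 v

section fin
variable (hgen : Algebra.adjoin K (Set.range t) = ⊤) (ht : ∀ i, IsNilpotent (t i))

include S ht in
lemma annSet_eq [FiniteDimensional K N] [Nontrivial N] :
    annSet K n V = (aIdeal K n Dᶜ : Set (In K n)) := by
  ext a
  constructor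
  · intro h
    obtain ⟨y, -, hy0, hy⟩ := exists_socle (K := K) ht (⊤ : Submodule A N) top_ne_bot
    exact S.ann_strong a y hy0 hy fun w => h _
  · intro h v
    exact S.aIdeal_le a h v

include S hgen ht in
lemma isPrime [FiniteDimensional K N] [Nontrivial N] :
    IsPrimeSet K n (aIdeal K n Dᶜ : Set (In K n)) := by
  refine ⟨?_, ?_⟩
  · rw [← S.annSet_eq ht]
    intro h
    have h1 : (1 : In K n) ∈ annSet K n V := by rw [h]; trivial
    obtain ⟨y, hy⟩ := exists_ne (0 : N)
    apply hy
    have := h1 (S.ι (fun _ => 1) y)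
    rw [one_smul] at this
    rw [← S.π_same (fun _ => 1) (by simp) y, this, map_zero]
  · intro a b hab
    by_contra hcon
    rw [not_or] at hcon
    obtain ⟨ha, hb⟩ := hcon
    apply ha
    have hb' : ∃ v : V, b • v ≠ 0 := by
      by_contra h
      push Not at h
      apply hb
      rw [← S.annSet_eq ht]
      exact h
    obtain ⟨v, hv⟩ := hb'
    let q : Submodule (In K n) V := Submodule.span (In K n) {b • v}
    let e := S.latIso hgen ht (fun _ => 1) (by simp)
    have hq : e q ≠ ⊥ := by
      intro h
      rw [← e.map_bot] at h
      have := e.injective h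
      apply hv
      rw [← Submodule.mem_bot (In K n), ← this]
      exact Submodule.mem_span_singleton_self _
    obtain ⟨y, hyq, hy0, hy⟩ := exists_socle (K := K) ht (e q) hq
    refine S.ann_strong a y hy0 hy fun w => ?_
    have h1 : S.ι w y ∈ q := S.transfer q (w := fun _ => 1) (by simp) y hyq
    obtain ⟨r, hr⟩ := Submodule.mem_span_singleton.1 h1
    rw [← hr, ← mul_smul, ← mul_smul]
    exact S.aIdeal_le _ (hab r) v

include S hgen ht in
lemma series [FiniteDimensional K N] : ∃ s : CompositionSeries (Submodule (In K n) V),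
      s.head = ⊥ ∧ s.last = ⊤ ∧ s.length = Module.finrank K N :=
  exists_series hgen ht (fun _ _ => Iff.rfl) (S.latIso hgen ht (fun _ => 1) (by simp))

end fin

lemma indec (S : Std D lam t A V) (hgen : Algebra.adjoin K (Set.range t) = ⊤) (ht : ∀ i, IsNilpotent (t i))
    [Nontrivial A] : IsIndecomposableMod K n V := by
  have := isLocal_A hgen ht
  let e := S.latIso hgen ht (fun _ => 1) (by simp)
  refine ⟨⟨⟨S.ι (fun _ => 1) 1, 0, fun h => ?_⟩⟩, ?_⟩
  · apply one_ne_zero (α := A)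
    rw [← S.π_same (fun _ => 1) (by simp) (1 : A), h, map_zero]
  · intro p q hpq
    have hpq' : IsCompl (e p) (e q) := (OrderIso.isCompl_iff e).1 hpq
    have h1 : e p = ⊤ ∨ e q = ⊤ := by
      by_contra h
      push Not at h
      have h2 := sup_le (IsLocalRing.le_maximalIdeal (J := e p) h.1) (IsLocalRing.le_maximalIdeal (J := e q) h.2)
      rw [hpq'.sup_eq_top] at h2
      exact (IsLocalRing.maximalIdeal.isMaximal A).ne_top (top_le_iff.1 h2)
    rcases h1 with h1 | h1
    · right
      have := hpq'.inf_eq_bot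
      rw [h1, top_inf_eq, ← e.map_bot] at this
      exact e.injective this
    · left
      have := hpq'.inf_eq_bot
      rw [h1, inf_top_eq, ← e.map_bot] at this
      exact e.injective this

include S in
lemma subq (hgen : Algebra.adjoin K (Set.range t) = ⊤) (ht : ∀ i, IsNilpotent (t i))
    (p q : Submodule (In K n) V) (hpq : p ≤ q)
    (hs : IsSimpleModule (In K n) (q ⧸ Submodule.comap q.subtype p)) :
    Nonempty (Std D lam (0 : Fin n → K) K (q ⧸ Submodule.comap q.subtype p)) := by
  have hcov := (covBy_iff_quot_is_simple hpq).2 hs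
  let e := S.latIso hgen ht (fun _ => 1) (by simp)
  have hcov' : e p ⋖ e q := (apply_covBy_apply_iff e).2 hcov
  obtain ⟨y, hyq, hyp, hgen'⟩ := cov_gen hgen ht hcov'
  have hty : ∀ i, t i • y ∈ e p := fun i => cov_t ht hcov' i y hyq
  have tr : ∀ r : Submodule (In K n) V, ∀ y, y ∈ e r → ∀ w, S.ι w y ∈ r := fun r y hy w =>
    S.transfer r (w := fun _ => 1) (by simp) y hy
  obtain ⟨ψ, hψ1, hψ2⟩ : ∃ ψ : N →ₗ[K] K, ψ y = 1 ∧ ∀ z ∈ e p, ψ z = 0 := by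
    obtain ⟨f, hf, hf'⟩ := Submodule.exists_le_ker_of_notMem (p := (e p).restrictScalars K) (v := y) hyp
    exact ⟨(f y)⁻¹ • f, by simp [hf], fun z hz => by
      have : f z = 0 := hf' hz
      simp [this]⟩
  let g : (Fin n → ℤ) → q := fun w => ⟨S.ι w y, tr q y hyq w⟩
  let Pp := Submodule.comap q.subtype p
  let π' : (Fin n → ℤ) → (q ⧸ Pp) →ₗ[K] K := fun w =>
    ((Pp.restrictScalars K).liftQ (ψ ∘ₗ S.π w ∘ₗ (q.restrictScalars K).subtype) (by
      intro v hv
      have hv' : (v : V) ∈ p := hv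
      rw [LinearMap.mem_ker]
      apply hψ2
      exact (S.mem_iff hgen ht p (w0 := fun _ => 1) (by simp) _).1 hv' w)) ∘ₗ
    (Submodule.Quotient.restrictScalarsEquiv K Pp).symm.toLinearMap
  have hπ : ∀ w (v : q), π' w (Submodule.Quotient.mk v) = ψ (S.π w v) := fun w v => rfl
  have mk0 : ∀ v : q, (v : V) ∈ p → (Submodule.Quotient.mk v : q ⧸ Pp) = 0 := fun v hv =>
    (Submodule.Quotient.mk_eq_zero _).2 hv
  have mkeq : ∀ v v' : q, (v : V) - v' ∈ p → (Submodule.Quotient.mk v : q ⧸ Pp) = Submodule.Quotient.mk v' :=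
    fun v v' hv => (Submodule.Quotient.eq _).2 hv
  have hsm : ∀ (a : In K n) (w : Fin n → ℤ) (c : K) (w' : Fin n → ℤ) (d : K),
      a • S.ι w y - d • S.ι w' y ∈ p →
      a • (c • (Submodule.Quotient.mk (g w) : q ⧸ Pp)) = (d * c) • (Submodule.Quotient.mk (g w') : q ⧸ Pp) := by
    intro a w c w' d h
    rw [← smul_comm c a, mul_comm, mul_smul]
    congr 1
    rw [← algebraMap_smul (In K n) d (Submodule.Quotient.mk (g w') : q ⧸ Pp), ← Submodule.Quotient.mk_smul, ← Submodule.Quotient.mk_smul]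
    apply mkeq
    show a • S.ι w y - algebraMap K (In K n) d • S.ι w' y ∈ p
    rwa [algebraMap_smul]
  refine ⟨{ ι := fun w => LinearMap.toSpanSingleton K _ (Submodule.Quotient.mk (g w))
            π := π'
            lam0 := S.lam0
            t0 := fun _ _ => rfl
            zero := ?_
            π_same := ?_
            π_ne := ?_
            span := ?_
            hd := ?_
            hint := ?_
            hx := ?_ }⟩
  · intro w i hi hw
    ext
    simp only [LinearMap.toSpanSingleton_apply, one_smul, LinearMap.zero_apply]
    apply mk0
    show S.ι w y ∈ p
    rw [S.zero w i hi hw]; simp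
  · intro w hw c
    rw [LinearMap.toSpanSingleton_apply, map_smul, hπ]
    show c • ψ (S.π w (S.ι w y)) = c
    rw [S.π_same w hw, hψ1]; simp
  · intro w w' hw c
    rw [LinearMap.toSpanSingleton_apply, map_smul, hπ]
    show c • ψ (S.π w (S.ι w' y)) = 0
    rw [S.π_ne w _ hw]; simp
  · intro v
    obtain ⟨u, rfl⟩ := Submodule.Quotient.mk_surjective _ v
    obtain ⟨s, hs⟩ := S.decomp (u : V)
    have h1 : ∀ w, ∃ c : K, S.π w u - c • y ∈ e p := fun w =>
      hgen' _ ((S.mem_iff hgen ht q (w0 := fun _ => 1) (by simp) _).1 u.2 w)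
    choose c hc using h1
    have h2 : (Submodule.Quotient.mk u : q ⧸ Pp) = Submodule.Quotient.mk (∑ w ∈ s, c w • g w) := by
      apply mkeq
      rw [hs s subset_rfl]
      rw [show ((∑ w ∈ s, c w • g w : q) : V) = ∑ w ∈ s, c w • S.ι w y by
        rw [Submodule.coe_sum]; rfl]
      rw [← Finset.sum_sub_distrib]
      refine sum_mem fun w _ => ?_
      rw [← map_smul, ← map_sub]
      exact tr p _ (hc w) w
    rw [h2, ← Submodule.mkQ_apply, map_sum]
    refine sum_mem fun w _ => Submodule.mem_iSup_of_mem w ⟨c w, ?_⟩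
    rw [LinearMap.toSpanSingleton_apply]; rfl
  · intro i w c
    rw [LinearMap.toSpanSingleton_apply, LinearMap.toSpanSingleton_apply, hsm _ w c (w - Pi.single i 1) 1, one_mul]
    rw [S.hd]; simp
  · intro i w c h
    rw [LinearMap.toSpanSingleton_apply, LinearMap.toSpanSingleton_apply, hsm _ w c (w + Pi.single i 1) 1, one_mul]
    rw [S.hint _ _ _ h]; simp
  · intro i w c
    rw [LinearMap.toSpanSingleton_apply, LinearMap.toSpanSingleton_apply, hsm _ w c (w + Pi.single i 1) (lam i + w i)]
    · simp
    · rw [S.hx, map_add, map_smul, add_sub_cancel_left]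
      exact tr p _ (hty i) _

end Std

end StdSec4

noncomputable section StdSec5

section
variable {K : Type*} [Field K] [CharZero K] {n : ℕ}

variable (K n) in
def polyD : MvPolynomial (Fin n) K →ₐ[K] Dn K n := MvPolynomial.aeval (HElD K n)

lemma dnVal_smul' (c : K) (d : Dn K n) : dnVal K n (algebraMap K (Dn K n) c * d) = c • dnVal K n d := by
  rw [map_mul, dnVal_algebraMap, Algebra.smul_def]

lemma dnVal_inj : Function.Injective (dnVal K n) := fun _ _ h => Subtype.ext h

lemma polyD_act {D : Set (Fin n)} {lam : Fin n → K}
    {A : Type*} [CommRing A] [Algebra K A] {t : Fin n → A}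
    {N : Type*} [AddCommGroup N] [Module K N] [Module A N] [IsScalarTower K A N]
    {V : Type*} [AddCommGroup V] [Module K V] [Module (In K n) V]
    [IsScalarTower K (In K n) V] (S : Std D lam t N V) (f : MvPolynomial (Fin n) K) (w y) :
    dnVal K n (polyD K n f) • S.ι w y = S.ι w (MvPolynomial.aeval (Std.wt lam t w) f • y) := by
  induction f using MvPolynomial.induction_on generalizing y with
  | C a =>
    rw [polyD, MvPolynomial.aeval_C, dnVal_algebraMap, algebraMap_smul, MvPolynomial.aeval_C,
      algebraMap_smul, map_smul]
  | add p q hp hq => rw [map_add, map_add, add_smul, hp, hq, map_add, add_smul, map_add]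
  | mul_X p i hp =>
    rw [map_mul, map_mul, mul_smul, map_mul, mul_smul, ← hp]
    congr 1
    rw [polyD, MvPolynomial.aeval_X, MvPolynomial.aeval_X]
    exact S.hH i w y

lemma polyD_surj : Function.Surjective (polyD K n) := by
  rintro ⟨a, ha⟩
  have key : ∃ f, dnVal K n (polyD K n f) = a := by
    induction ha using Algebra.adjoin_induction with
    | mem x hx =>
      obtain ⟨i, rfl⟩ := hx
      exact ⟨MvPolynomial.X i, by rw [polyD, MvPolynomial.aeval_X]; rfl⟩
    | algebraMap c => exact ⟨MvPolynomial.C c, by rw [polyD, MvPolynomial.aeval_C, dnVal_algebraMap]⟩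
    | add a b _ _ ha hb =>
      obtain ⟨f, hf⟩ := ha
      obtain ⟨g, hg⟩ := hb
      exact ⟨f + g, by rw [map_add, map_add, hf, hg]⟩
    | mul a b _ _ ha hb =>
      obtain ⟨f, hf⟩ := ha
      obtain ⟨g, hg⟩ := hb
      exact ⟨f * g, by rw [map_mul, map_mul, hf, hg]⟩
  obtain ⟨f, hf⟩ := key
  exact ⟨f, dnVal_inj hf⟩

lemma polyD_stdP (f : MvPolynomial (Fin n) K) (w y) :
    dnVal K n (polyD K n f) • stdP.ι w (y : K)
      = stdP.ι w (MvPolynomial.eval (fun i => (w i : K)) f * y) := by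
  rw [polyD_act, Std.aeval_socle y (by simp)]
  simp

lemma polyD_inj : Function.Injective (polyD K n) := by
  rw [injective_iff_map_eq_zero]
  intro f hf
  apply poly_zero (fun _ => 0) 0 f
  intro w hw
  have := polyD_stdP f w 1
  rw [hf, map_zero, zero_smul] at this
  have h2 := congrArg (stdP.π w) this
  rw [map_zero, stdP.π_same w (fun i _ => hw i), mul_one] at h2
  simpa using h2.symm

variable (K n) in
def evD (lam : Fin n → K) : Dn K n →+* K :=
  (MvPolynomial.eval lam).comp (AlgEquiv.ofBijective (polyD K n) ⟨polyD_inj, polyD_surj⟩).symm.toAlgHom.toRingHom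

lemma evD_polyD (lam : Fin n → K) (f) : evD K n lam (polyD K n f) = MvPolynomial.eval lam f := by
  have : (AlgEquiv.ofBijective (polyD K n) ⟨polyD_inj, polyD_surj⟩).symm (polyD K n f) = f :=
    (AlgEquiv.ofBijective (polyD K n) ⟨polyD_inj, polyD_surj⟩).symm_apply_apply f
  show MvPolynomial.eval lam ((AlgEquiv.ofBijective (polyD K n) ⟨polyD_inj, polyD_surj⟩).symm (polyD K n f)) = _
  rw [this]

lemma mIdeal_ne_top (lam : Fin n → K) : mIdeal K n lam ≠ ⊤ := by
  have : mIdeal K n lam ≤ RingHom.ker (evD K n lam) := by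
    rw [mIdeal, Ideal.span_le]
    rintro _ ⟨i, rfl⟩
    rw [SetLike.mem_coe, RingHom.mem_ker]
    have h1 : HElD K n i = polyD K n (MvPolynomial.X i) := by rw [polyD, MvPolynomial.aeval_X]
    have h2 : algebraMap K (Dn K n) (lam i) = polyD K n (MvPolynomial.C (lam i)) := by
      rw [polyD, MvPolynomial.aeval_C]
    rw [h1, h2, map_sub, evD_polyD, evD_polyD]; simp
  intro h
  rw [h, top_le_iff] at this
  exact RingHom.ker_ne_top _ this

lemma toBn_eq_zero (a : In K n) : toBn K n a = 0 ↔ a ∈ aFull K n := by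
  rw [TwoSidedIdeal.mem_iff, ← RingCon.eq]; rfl

lemma toBn_eq (a b : In K n) (M : ℕ)
    (h : ∀ w : Fin n → ℤ, (∀ i, (M : ℤ) < w i) → a • stdP.ι w (1 : K) = b • stdP.ι w 1) :
    toBn K n a = toBn K n b := by
  rw [← sub_eq_zero, ← map_sub, toBn_eq_zero]
  refine mem_aIdeal_of_kills _ _ M fun w _ hw => ?_
  rw [sub_smul, h w (fun i => hw i trivial), sub_self]

lemma toBn_d (i : Fin n) (z) : toBn K n (dEl K n i * vEl K z) = toBn K n (vEl K (z - Pi.single i 1)) := by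
  refine toBn_eq _ _ 0 fun w hw => ?_
  rw [mul_smul, stdP.hv _ _ _ (fun i _ => hw i), stdP.hd, stdP.hv _ _ _ (fun i _ => hw i), add_sub_assoc]

lemma toBn_int (i : Fin n) (z) : toBn K n (intEl K n i * vEl K z) = toBn K n (vEl K (z + Pi.single i 1)) := by
  refine toBn_eq _ _ (z i).natAbs fun w hw => ?_
  have h0 : ∀ i ∈ Set.univ, 0 < w i := fun j _ => lt_of_le_of_lt (by positivity) (hw j)
  rw [mul_smul, stdP.hv _ _ _ h0, stdP.hint, stdP.hv _ _ _ h0, add_assoc]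
  intro _
  have := hw i
  simp only [Pi.add_apply]
  omega

lemma toBn_x (i : Fin n) (z : Fin n → ℤ) : toBn K n (xEl K n i * vEl K z)
    = toBn K n (vEl K (z + Pi.single i 1) * dnVal K n (HElD K n i + algebraMap K (Dn K n) (z i : K))) := by
  refine toBn_eq _ _ 0 fun w hw => ?_
  have e : HElD K n i + algebraMap K (Dn K n) (z i : K) = polyD K n (MvPolynomial.X i + MvPolynomial.C (z i : K)) := by
    rw [polyD, map_add, MvPolynomial.aeval_X, MvPolynomial.aeval_C]
  rw [mul_smul, stdP.hv _ _ _ (fun i _ => hw i), mul_smul, e, polyD_stdP, stdP.hx, stdP.hv _ _ _ (fun i _ => hw i), add_assoc]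
  simp

lemma exists_list (a : In K n) : ∃ (L : List ((Fin n → ℤ) × MvPolynomial (Fin n) K)) (M : ℕ),
    ∀ w : Fin n → ℤ, (∀ i, (M : ℤ) < w i) → a • stdP.ι w (1 : K)
      = (L.map fun e => vEl K e.1 * dnVal K n (polyD K n e.2)).sum • stdP.ι w (1 : K) := by
  obtain ⟨M, h⟩ := (stdP (K := K) (n := n)).exists_acts stdP ∅ (by simp) (by simp) a
  obtain ⟨L, -, h1, -⟩ := h 0
  refine ⟨L, M, fun w hw => ?_⟩
  rw [h1 w (by simp) (fun i _ _ => hw i)]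
  have h0 : ∀ i ∈ Set.univ, 0 < w i := fun j _ => lt_of_le_of_lt (by positivity) (hw j)
  clear h1 h
  induction L with
  | nil => simp
  | cons e L ih =>
    simp only [List.map_cons, List.sum_cons, add_smul]
    rw [ih, mul_smul, polyD_stdP, stdP.hv _ _ _ h0, Std.aeval_socle (1 : K) (by simp)]
    simp

lemma bn_smul (d : Dn K n) (a : In K n) : d • toBn K n a = toBn K n (a * dnVal K n d) := by
  rw [map_mul]; rfl

variable (K n) in
def bB : Module.Basis (Fin n → ℤ) (Dn K n) (Bn K n) :=
  Module.Basis.mk (v := fun z => toBn K n (vEl K z)) (by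
    rw [linearIndependent_iff']
    intro s g hg z0 hz0
    choose f hf using fun z => polyD_surj (g z)
    have h1 : toBn K n (∑ z ∈ s, vEl K z * dnVal K n (g z)) = 0 := by
      rw [map_sum, ← hg]
      exact Finset.sum_congr rfl fun z _ => (bn_smul _ _).symm
    rw [toBn_eq_zero] at h1
    obtain ⟨M, hM⟩ := kills_of_mem_aFull _ h1
    rw [← hf, poly_zero 0 ((M : ℤ) + ∑ i, ((z0 i).natAbs : ℤ)) (f z0), map_zero]
    intro w hw
    have hw1 : ∀ i, (M : ℤ) < w i := fun i => lt_of_le_of_lt (by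
      have : (0 : ℤ) ≤ ∑ i, ((z0 i).natAbs : ℤ) := by positivity
      omega) (hw i)
    have h0 : ∀ i ∈ Set.univ, 0 < w i := fun j _ => lt_of_le_of_lt (by positivity) (hw1 j)
    have h2 := congrArg (stdP.π (w + z0)) (hM w hw1 1)
    rw [Finset.sum_smul, map_sum, map_zero, Finset.sum_eq_single z0] at h2
    · rw [mul_smul, ← hf, polyD_stdP, stdP.hv _ _ _ h0, stdP.π_same, mul_one] at h2
      · simpa using h2
      · intro i _
        have h3 := hw i
        have h4 : ((z0 i).natAbs : ℤ) ≤ ∑ i, ((z0 i).natAbs : ℤ) :=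
          Finset.single_le_sum (f := fun i => ((z0 i).natAbs : ℤ)) (fun _ _ => by positivity) (Finset.mem_univ i)
        simp only [Pi.add_apply]
        omega
    · intro z _ hz
      rw [mul_smul, ← hf, polyD_stdP, stdP.hv _ _ _ h0, stdP.π_ne]
      intro h
      exact hz (add_left_cancel h).symm
    · intro h; exact absurd hz0 h) (by
    intro b _
    obtain ⟨a, rfl⟩ := toBn_surjective K n b
    obtain ⟨L, M, h⟩ := exists_list a
    rw [toBn_eq _ _ M h, map_list_sum, List.map_map]
    refine list_sum_mem ?_
    intro x hx
    obtain ⟨e, -, rfl⟩ := List.mem_map.1 hx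
    simp only [Function.comp_apply]
    rw [← bn_smul]
    exact Submodule.smul_mem _ _ (Submodule.subset_span ⟨_, rfl⟩))

lemma bB_apply (z) : bB K n z = toBn K n (vEl K z) := by
  rw [bB, Module.Basis.mk_apply]

def indT {N : Type*} [AddCommGroup N] [Module (Dn K n) N] (b : Bn K n) (y : N) : Ind K n N :=
  (b ⊗ₜ[Dn K n] y : Bn K n ⊗[Dn K n] N)

lemma bnsmul_tmul {N : Type*} [AddCommGroup N] [Module (Dn K n) N] (a : In K n) (b : In K n) (y : N) :
    a • (indT (toBn K n b) y : Ind K n N) = indT (toBn K n (a * b)) y := by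
  rw [map_mul]; rfl

variable (I : Ideal (Dn K n)) (lam : Fin n → K)

def tI (i : Fin n) : Dn K n ⧸ I := Ideal.Quotient.mk I (HElD K n i - algebraMap K (Dn K n) (lam i))

lemma tI_gen : Algebra.adjoin K (Set.range (tI I lam)) = ⊤ := by
  rw [eq_top_iff]
  rintro x -
  obtain ⟨d, rfl⟩ := Ideal.Quotient.mk_surjective x
  obtain ⟨f, rfl⟩ := polyD_surj d
  have hC : ∀ c : K, Ideal.Quotient.mk I (algebraMap K (Dn K n) c) ∈ Algebra.adjoin K (Set.range (tI I lam)) :=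
    fun c => Subalgebra.algebraMap_mem _ c
  induction f using MvPolynomial.induction_on with
  | C a => rw [polyD, MvPolynomial.aeval_C]; exact hC a
  | add p q hp hq => rw [map_add, map_add]; exact add_mem hp hq
  | mul_X p i hp =>
    rw [map_mul, map_mul]
    refine mul_mem hp ?_
    rw [polyD, MvPolynomial.aeval_X]
    have : Ideal.Quotient.mk I (HElD K n i) = tI I lam i + Ideal.Quotient.mk I (algebraMap K (Dn K n) (lam i)) := by
      rw [tI, ← map_add, sub_add_cancel]
    rw [this]
    exact add_mem (Algebra.subset_adjoin ⟨i, rfl⟩) (hC _)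

lemma tI_nil {k : ℕ} (hk : mIdeal K n lam ^ k ≤ I) (i) : IsNilpotent (tI I lam i) := by
  refine ⟨k, ?_⟩
  rw [tI, ← map_pow, Ideal.Quotient.eq_zero_iff_mem]
  have h : HElD K n i - algebraMap K (Dn K n) (lam i) ∈ mIdeal K n lam :=
    Ideal.subset_span ⟨i, rfl⟩
  exact hk (Ideal.pow_mem_pow h k)

omit [CharZero K] in
lemma fin_of_nil {A : Type*} [CommRing A] [Algebra K A] {t : Fin n → A}
    (hgen : Algebra.adjoin K (Set.range t) = ⊤) (ht : ∀ i, IsNilpotent (t i)) : FiniteDimensional K A := by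
  have h := fg_adjoin_of_finite (R := K) (A := A) (Set.finite_range t) (by
    rintro _ ⟨i, rfl⟩
    obtain ⟨k, hk⟩ := ht i
    exact (⟨Polynomial.X ^ k, Polynomial.monic_X_pow k, by simp [hk]⟩ : IsIntegral K (t i)))
  rw [hgen, Algebra.top_toSubmodule] at h
  exact ⟨h⟩

def stdInd : Std (∅ : Set (Fin n)) lam (tI I lam) (Dn K n ⧸ I) (Ind K n (Dn K n ⧸ I)) where
  ι z := 
    { toFun := fun y => (toBn K n (vEl K z) ⊗ₜ[Dn K n] y : Bn K n ⊗[Dn K n] (Dn K n ⧸ I))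
      map_add' := fun y y' => TensorProduct.tmul_add _ _ _
      map_smul' := fun c y => by
        rw [← algebraMap_smul (Dn K n) c y, TensorProduct.tmul_smul]; rfl }
  π z := 
    { toFun := fun v => TensorProduct.equivFinsuppOfBasisLeft (bB K n) (show Bn K n ⊗[Dn K n] (Dn K n ⧸ I) from v) z
      map_add' := fun u v => by
        have := map_add (TensorProduct.equivFinsuppOfBasisLeft (N := Dn K n ⧸ I) (bB K n)) u v
        exact DFunLike.congr_fun this z
      map_smul' := fun c v => by
        have := map_smul (TensorProduct.equivFinsuppOfBasisLeft (N := Dn K n ⧸ I) (bB K n)) (algebraMap K (Dn K n) c) (show Bn K n ⊗[Dn K n] (Dn K n ⧸ I) from v)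
        have := DFunLike.congr_fun this z
        exact this.trans (algebraMap_smul (Dn K n) c _) }
  lam0 := by simp
  t0 := by simp
  zero := by simp
  π_same w _ y := by
    show TensorProduct.equivFinsuppOfBasisLeft (bB K n) (toBn K n (vEl K w) ⊗ₜ[Dn K n] y) w = y
    rw [← bB_apply, TensorProduct.equivFinsuppOfBasisLeft_apply_tmul_apply]
    simp
  π_ne w w' h y := by
    show TensorProduct.equivFinsuppOfBasisLeft (bB K n) (toBn K n (vEl K w') ⊗ₜ[Dn K n] y) w = 0
    rw [← bB_apply, TensorProduct.equivFinsuppOfBasisLeft_apply_tmul_apply]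
    simp [Finsupp.single_eq_of_ne h]
  span v := by
    revert v
    suffices h : ∀ v : Bn K n ⊗[Dn K n] (Dn K n ⧸ I), ∃ l : (Fin n → ℤ) →₀ (Dn K n ⧸ I),
        v = l.sum fun z y => toBn K n (vEl K z) ⊗ₜ[Dn K n] y by
      intro v
      obtain ⟨l, hl⟩ := h v
      rw [hl]
      exact sum_mem fun z _ => Submodule.mem_iSup_of_mem z ⟨l z, rfl⟩
    intro v
    refine ⟨TensorProduct.equivFinsuppOfBasisLeft (bB K n) v, ?_⟩
    have := (TensorProduct.equivFinsuppOfBasisLeft (N := Dn K n ⧸ I) (bB K n)).symm_apply_apply v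
    rw [TensorProduct.equivFinsuppOfBasisLeft_symm_apply] at this
    conv_lhs => rw [← this]
    simp only [bB_apply]
  hd i w y := by
    show dEl K n i • (indT (toBn K n (vEl K w)) y : Ind K n (Dn K n ⧸ I)) = _
    rw [bnsmul_tmul, toBn_d]; rfl
  hint i w y _ := by
    show intEl K n i • (indT (toBn K n (vEl K w)) y : Ind K n (Dn K n ⧸ I)) = _
    rw [bnsmul_tmul, toBn_int]; rfl
  hx i w y := by
    show xEl K n i • (indT (toBn K n (vEl K w)) y : Ind K n (Dn K n ⧸ I)) = _
    rw [bnsmul_tmul, toBn_x, ← bn_smul]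
    show ((HElD K n i + algebraMap K (Dn K n) (w i : K)) • toBn K n (vEl K (w + Pi.single i 1))) ⊗ₜ[Dn K n] y = toBn K n (vEl K (w + Pi.single i 1)) ⊗ₜ[Dn K n] _
    rw [TensorProduct.smul_tmul]
    congr 1
    rw [add_smul, algebraMap_smul, add_smul, tI, Algebra.smul_def, Algebra.smul_def, Algebra.smul_def]
    obtain ⟨d, rfl⟩ := Ideal.Quotient.mk_surjective y
    have h1 : ∀ c : K, algebraMap K (Dn K n ⧸ I) c = Ideal.Quotient.mk I (algebraMap K (Dn K n) c) := fun _ => rfl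
    have h2 : algebraMap (Dn K n) (Dn K n ⧸ I) (HElD K n i) = Ideal.Quotient.mk I (HElD K n i) := rfl
    rw [h1, h1, h2, smul_eq_mul, map_sub]
    ring

end
end StdSec5

noncomputable section StdSec6

section
variable {K : Type*} [Field K] [CharZero K]

variable (K) in
def mslQ (mu : K) : In K 1 →ₗ[In K 1] Msl K 1 mu := (MslIdeal K 1 mu).mkQ

lemma mslQ_surj (mu : K) : Function.Surjective (mslQ K mu) := Submodule.mkQ_surjective _

lemma mslQ_smul (mu c : K) (a : In K 1) : mslQ K mu (c • a) = c • mslQ K mu a := rfl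

lemma mslQ_eq_zero (mu : K) (a : In K 1) : mslQ K mu a = 0 ↔ a ∈ MslIdeal K 1 mu :=
  Submodule.Quotient.mk_eq_zero _

lemma mslQ_eq (mu : K) (a b : In K 1) (M : ℕ)
    (h : ∀ w : Fin 1 → ℤ, (∀ i, (M : ℤ) < w i) → a • stdP.ι w (1 : K) = b • stdP.ι w 1) :
    mslQ K mu a = mslQ K mu b := by
  rw [← sub_eq_zero, ← map_sub, mslQ_eq_zero]
  refine Submodule.mem_sup_left ?_
  set c := a - b with hc
  have h1 : c * qEl K M 0 = 0 := by
    apply In_ext2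
    intro p
    rw [zero_smul]
    refine stdP.ind (p := fun p => (c * qEl K M 0) • p = 0) (smul_zero _) (fun w hw y => ?_)
      (fun u v hu hv => by rw [smul_add, hu, hv, add_zero]) p
    rw [mul_smul, q_act]
    split_ifs with hM
    · have : y = y • (1 : K) := by simp
      rw [this, map_smul, ← smul_comm, hc, sub_smul, h w, sub_self, smul_zero]
      intro i
      rwa [Subsingleton.elim i 0]
    · simp
  have h2 : c = c * (1 - qEl K M 0) := by rw [mul_sub, h1, mul_one, sub_zero]
  rw [h2, one_sub_q, Finset.mul_sum]
  refine sum_mem fun s _ => ?_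
  exact Submodule.smul_mem _ c (Submodule.subset_span ⟨s, s, rfl⟩)

lemma msl_H (mu : K) (a : In K 1) : mslQ K mu (a * HEl K 1 0) = mu • mslQ K mu a := by
  rw [← mslQ_smul, ← sub_eq_zero, ← map_sub, mslQ_eq_zero]
  refine Submodule.mem_sup_right ?_
  have : a * HEl K 1 0 - mu • a = a • (HEl K 1 0 - algebraMap K (In K 1) mu) ^ 1 := by
    rw [pow_one, smul_eq_mul, mul_sub, ← Algebra.commutes, ← Algebra.smul_def]
  rw [this]
  exact Submodule.smul_mem _ a (Submodule.subset_span rfl)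

lemma msl_poly (mu : K) (a : In K 1) (f : MvPolynomial (Fin 1) K) :
    mslQ K mu (a * dnVal K 1 (polyD K 1 f)) = MvPolynomial.eval (fun _ => mu) f • mslQ K mu a := by
  induction f using MvPolynomial.induction_on generalizing a with
  | C c =>
    rw [polyD, MvPolynomial.aeval_C, dnVal_algebraMap, ← Algebra.commutes, ← Algebra.smul_def, mslQ_smul]
    simp
  | add p q hp hq => rw [map_add, map_add, mul_add, map_add, hp, hq, map_add, add_smul]
  | mul_X p i hp =>
    have e : dnVal K 1 (polyD K 1 (MvPolynomial.X i)) = HEl K 1 0 := by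
      rw [polyD, MvPolynomial.aeval_X, Subsingleton.elim i 0]; rfl
    rw [map_mul (polyD K 1), map_mul (dnVal K 1), e, ← mul_assoc, msl_H, hp, smul_smul, map_mul, MvPolynomial.eval_X, mul_comm]

def mslS (mu : K) := stdInd (mIdeal K 1 (fun _ => mu)) (fun _ => mu)

lemma tI_max (mu : K) (i : Fin 1) : tI (mIdeal K 1 (fun _ => mu)) (fun _ => mu) i = 0 := by
  rw [tI, Ideal.Quotient.eq_zero_iff_mem]
  have h : HElD K 1 i - algebraMap K (Dn K 1) mu ∈ mIdeal K 1 (fun _ => mu) :=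
    Ideal.subset_span ⟨i, rfl⟩
  exact h

def mslR (mu : K) : Msl K 1 mu →ₗ[In K 1] Ind K 1 (Dn K 1 ⧸ mIdeal K 1 (fun _ => mu)) :=
  (MslIdeal K 1 mu).liftQ (LinearMap.toSpanSingleton (In K 1) _ ((mslS mu).ι 0 1)) (by
    rw [MslIdeal, sup_le_iff, Fideal, Submodule.span_le, Submodule.span_le]
    constructor
    · rintro _ ⟨s, r, rfl⟩
      show eElN K 1 0 s r • (mslS mu).ι 0 1 = 0
      refine (mslS mu).aIdeal_le _ ?_ _
      exact eElN_mem 0 _ (by simp) s r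
    · rintro _ rfl
      show (HEl K 1 0 - algebraMap K (In K 1) mu) ^ 1 • (mslS mu).ι 0 1 = 0
      rw [pow_one, sub_smul, (mslS mu).hH, algebraMap_smul, ← map_smul, ← map_sub, Std.wt, tI_max]
      simp [← Algebra.algebraMap_eq_smul_one])

lemma mslR_apply (mu : K) (a : In K 1) : mslR mu (mslQ K mu a) = a • (mslS mu).ι 0 1 := rfl

lemma exists_psi (mu : K) : ∃ ψ : (Dn K 1 ⧸ mIdeal K 1 (fun _ => mu)) →ₗ[K] K, ψ 1 = 1 := by
  have : Nontrivial (Dn K 1 ⧸ mIdeal K 1 (fun _ => mu)) :=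
    Ideal.Quotient.nontrivial_iff.2 (mIdeal_ne_top _)
  obtain ⟨f, -, hf⟩ := LinearMap.exists_extend_of_notMem
    (p := (⊥ : Submodule K (Dn K 1 ⧸ mIdeal K 1 (fun _ => mu)))) (0 : _ →ₗ[K] K) (v := 1) (by simp) 1
  exact ⟨f, hf⟩

def stdMsl (mu : K) : Std (∅ : Set (Fin 1)) (fun _ => mu) (0 : Fin 1 → K) K (Msl K 1 mu) where
  ι z := LinearMap.toSpanSingleton K _ (mslQ K mu (vEl K z))
  π z := (Classical.choose (exists_psi mu)) ∘ₗ (mslS mu).π z ∘ₗ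
    { toFun := fun v => mslR mu v
      map_add' := fun u v => map_add _ _ _
      map_smul' := fun c v => by
        show mslR mu (c • v) = c • mslR mu v
        rw [← algebraMap_smul (In K 1) c v, map_smul, algebraMap_smul] }
  lam0 := by simp
  t0 := by simp
  zero := by simp
  π_same w _ y := by
    show Classical.choose (exists_psi mu) ((mslS mu).π w (mslR mu (y • mslQ K mu (vEl K w)))) = y
    rw [← mslQ_smul, mslR_apply, smul_assoc, (mslS mu).hv _ _ _ (by simp), map_smul, zero_add,
      (mslS mu).π_same _ (by simp), map_smul, Classical.choose_spec (exists_psi mu)]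
    simp
  π_ne w w' h y := by
    show Classical.choose (exists_psi mu) ((mslS mu).π w (mslR mu (y • mslQ K mu (vEl K w')))) = 0
    rw [← mslQ_smul, mslR_apply, smul_assoc, (mslS mu).hv _ _ _ (by simp), map_smul, zero_add,
      (mslS mu).π_ne _ _ h]
    simp
  span v := by
    obtain ⟨a, rfl⟩ := mslQ_surj mu v
    obtain ⟨L, M, h⟩ := exists_list a
    rw [mslQ_eq mu _ _ M h, map_list_sum, List.map_map]
    refine list_sum_mem ?_
    intro x hx
    obtain ⟨e, -, rfl⟩ := List.mem_map.1 hx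
    simp only [Function.comp_apply]
    rw [msl_poly]
    exact Submodule.mem_iSup_of_mem e.1 ⟨_, rfl⟩
  hd i w y := by
    rw [LinearMap.toSpanSingleton_apply, LinearMap.toSpanSingleton_apply, ← smul_comm, ← map_smul]
    congr 1
    refine mslQ_eq mu _ _ 0 fun w' hw => ?_
    rw [smul_eq_mul, mul_smul, stdP.hv _ _ _ (fun i _ => hw i), stdP.hd,
      stdP.hv _ _ _ (fun i _ => hw i), add_sub_assoc]
  hint i w y _ := by
    rw [LinearMap.toSpanSingleton_apply, LinearMap.toSpanSingleton_apply, ← smul_comm, ← map_smul]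
    congr 1
    refine mslQ_eq mu _ _ (w i).natAbs fun w' hw => ?_
    have h0 : ∀ i ∈ Set.univ, 0 < w' i := fun j _ => lt_of_le_of_lt (by positivity) (hw j)
    rw [smul_eq_mul, mul_smul, stdP.hv _ _ _ h0, stdP.hint, stdP.hv _ _ _ h0, add_assoc]
    intro _
    have := hw i
    simp only [Pi.add_apply]
    omega
  hx i w y := by
    rw [LinearMap.toSpanSingleton_apply, LinearMap.toSpanSingleton_apply, ← smul_comm, ← map_smul]
    have e : mslQ K mu (xEl K 1 i • vEl K w) = mslQ K mu (vEl K (w + Pi.single i 1) *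
        dnVal K 1 (polyD K 1 (MvPolynomial.X i + MvPolynomial.C (w i : K)))) := by
      refine mslQ_eq mu _ _ 0 fun w' hw => ?_
      rw [smul_eq_mul, mul_smul, stdP.hv _ _ _ (fun i _ => hw i), mul_smul, polyD_stdP, stdP.hx,
        stdP.hv _ _ _ (fun i _ => hw i), add_assoc]
      simp
    rw [e, msl_poly, smul_smul]
    congr 1
    simp [mul_comm]

end
end StdSec6

noncomputable section StdSec7

namespace Std
variable {K : Type*} [Field K] [CharZero K] {n : ℕ} {D : Set (Fin n)} {lam : Fin n → K}
    {V : Type*} [AddCommGroup V] [Module K V] [Module (In K n) V]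
    [IsScalarTower K (In K n) V] (S : Std D lam (0 : Fin n → K) K V)

def bas : Module.Basis {w : Fin n → ℤ // ∀ i ∈ D, 0 < w i} K V :=
  Module.Basis.mk (v := fun w => S.ι w.1 1) (by
    rw [linearIndependent_iff']
    intro s g hg z hz
    have h := congrArg (S.π z.1) hg
    rw [map_sum, map_zero, Finset.sum_eq_single z] at h
    · rw [map_smul, S.π_same _ z.2] at h
      simpa using h
    · intro b _ hb
      rw [map_smul, S.π_ne _ _ (fun h => hb (Subtype.ext h.symm)), smul_zero]
    · intro h; exact absurd hz h) (by
    intro v _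
    refine S.ind (p := fun v => v ∈ _) (zero_mem _) (fun w hw y => ?_) (fun u v hu hv => add_mem hu hv) v
    have : y = y • (1 : K) := by simp
    rw [this, map_smul]
    exact Submodule.smul_mem _ _ (Submodule.subset_span ⟨⟨w, hw⟩, rfl⟩))

lemma bas_apply (w) : S.bas w = S.ι w.1 1 := by rw [bas, Module.Basis.mk_apply]
end Std

section
universe u
variable {K : Type u} [Field K] [CharZero K] {n : ℕ} {D : Set (Fin n)} {lam : Fin n → K}
    {V : Type*} [AddCommGroup V] [Module K V] [Module (In K n) V]
    [IsScalarTower K (In K n) V]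

def idxE (D : Set (Fin n)) : {w : Fin n → ℤ // ∀ i ∈ D, 0 < w i} ≃
    ((j : Fin n) → {w : Fin 1 → ℤ // ∀ i ∈ {_i : Fin 1 | j ∈ D}, 0 < w i}) where
  toFun w j := ⟨fun _ => w.1 j, fun _ hj => w.2 j hj⟩
  invFun f := ⟨fun j => (f j).1 0, fun j hj => (f j).2 0 hj⟩
  left_inv w := rfl
  right_inv f := by
    funext j
    apply Subtype.ext
    funext i
    rw [Subsingleton.elim i 0]

variable (Mi : Fin n → ModN K 1)
  (T : ∀ j, Std {_i : Fin 1 | j ∈ D} (fun _ => lam j) (0 : Fin 1 → K) K (Mi j).carrier)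

def tt (w : Fin n → ℤ) : ⨂[K] j, (Mi j).carrier := PiTensorProduct.tprod K fun j => (T j).ι (fun _ => w j) 1

lemma tt_zero (w : Fin n → ℤ) (i) (hi : i ∈ D) (h : w i ≤ 0) : tt Mi T w = 0 := by
  refine MultilinearMap.map_coord_zero _ i ?_
  rw [(T i).zero (fun _ => w i) 0 hi h]; rfl

lemma tt_map (w : Fin n → ℤ) (i : Fin n) (z : ℤ) (c : K) (a : In K 1)
    (h : a • (T i).ι (fun _ => w i) 1 = (T i).ι ((fun _ => w i) + Pi.single 0 z) c) :
    tprodMap K n Mi i a (tt Mi T w) = c • tt Mi T (w + Pi.single i z) := by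
  rw [tprodMap, tt, PiTensorProduct.map_tprod]
  have e : (fun j => (Function.update
    (fun j => (LinearMap.id : (Mi j).carrier →ₗ[K] (Mi j).carrier)) i
    (DistribMulAction.toLinearMap K ((Mi i).carrier) a)) j ((T j).ι (fun _ => w j) 1))
      = Function.update (fun j => (T j).ι (fun _ => (w + Pi.single i z : Fin n → ℤ) j) 1) i (c • (T i).ι (fun _ => (w + Pi.single i z : Fin n → ℤ) i) 1) := by
    funext j
    by_cases hj : j = i
    · subst hj
      rw [Function.update_self, Function.update_self]
      refine (show _ = a • (T j).ι (fun _ => w j) 1 from rfl).trans ?_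
      rw [h, ← map_smul]
      congr 1
      · congr 1
        funext x
        rw [Subsingleton.elim x 0]; simp
      · simp
    · rw [Function.update_of_ne hj, Function.update_of_ne hj]
      simp [Pi.single_eq_of_ne hj]
  rw [e, MultilinearMap.map_update_smul, Function.update_eq_self]
  rfl

include T in
theorem realizesTensor (S : Std D lam (0 : Fin n → K) K V) : RealizesTensor K n Mi V := by
  let φ : V ≃ₗ[K] ⨂[K] j, (Mi j).carrier :=
    S.bas.equiv (Basis.piTensorProduct fun j => (T j).bas) (idxE D)
  have hφ : ∀ w, φ (S.ι w 1) = tt Mi T w := by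
    intro w
    by_cases hw : ∀ i ∈ D, 0 < w i
    · have := S.bas.equiv_apply ⟨w, hw⟩ (Basis.piTensorProduct fun j => (T j).bas) (idxE D)
      rw [S.bas_apply] at this
      refine this.trans ?_
      rw [Basis.piTensorProduct_apply]
      simp only [Std.bas_apply]
      rfl
    · push Not at hw
      obtain ⟨i, hi, h⟩ := hw
      rw [S.zero w i hi h, tt_zero Mi T w i hi h]; simp
  have hφ' : ∀ w c, φ (S.ι w c) = c • tt Mi T w := by
    intro w c
    have : c = c • (1 : K) := by simp
    rw [this, map_smul, map_smul, hφ]; simp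
  have key : ∀ (i : Fin n) (a : In K n) (b : In K 1), (∀ w, (∀ i ∈ D, 0 < w i) → ∃ z c, a • S.ι w 1 = S.ι (w + Pi.single i z) c ∧
      b • (T i).ι (fun _ => w i) 1 = (T i).ι ((fun _ => w i) + Pi.single 0 z) c) → ∀ m, φ (a • m) = tprodMap K n Mi i b (φ m) := by
    intro i a b h m
    refine S.ind (p := fun m => φ (a • m) = tprodMap K n Mi i b (φ m)) (by simp) (fun w hw y => ?_)
      (fun u v hu hv => by rw [smul_add, map_add, hu, hv, map_add, map_add]) m
    obtain ⟨z, c, h1, h2⟩ := h w hw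
    have : y = y • (1 : K) := by simp
    rw [this, map_smul (S.ι w), ← smul_comm, h1, map_smul φ, map_smul φ, map_smul (tprodMap K n Mi i b), hφ, tt_map Mi T w i z c b h2, hφ']
  refine ⟨φ, fun i m => ⟨key _ _ _ (fun w hw => ⟨1, _, S.hx i w 1, ?_⟩) m,
    key _ _ _ (fun w hw => ⟨-1, 1, ?_, ?_⟩) m, key _ _ _ (fun w hw => ⟨1, 1, S.hint i w 1 (hw i), (T i).hint 0 _ 1 (fun h => hw i h)⟩) m⟩⟩
  · rw [(T i).hx]; simp
  · rw [S.hd, sub_eq_add_neg, Pi.single_neg]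
  · rw [(T i).hd, sub_eq_add_neg, Pi.single_neg]

theorem realizesMD (S : Std D lam (0 : Fin n → K) K V) : RealizesMD K n lam D V := by
  have key : ∀ i : Fin n, ∃ M : ModN K 1,
      Nonempty (Std {_i : Fin 1 | i ∈ D} (fun _ => lam i) (0 : Fin 1 → K) K M.carrier) ∧
      (i ∈ D → Nonempty (M.carrier ≃ₗ[In K 1] P K 1)) ∧
      (i ∉ D → Nonempty (M.carrier ≃ₗ[In K 1] Msl K 1 (lam i))) := by
    intro i
    by_cases hi : i ∈ D
    · refine ⟨⟨P K 1⟩, ?_, fun _ => ⟨LinearEquiv.refl _ _⟩, fun h => absurd hi h⟩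
      have e : {_i : Fin 1 | i ∈ D} = Set.univ := by ext; simp [hi]
      rw [e, S.lam0 i hi]
      exact ⟨stdP⟩
    · refine ⟨⟨Msl K 1 (lam i)⟩, ?_, fun h => absurd h hi, fun _ => ⟨LinearEquiv.refl _ _⟩⟩
      have e : {_i : Fin 1 | i ∈ D} = ∅ := by ext; simp [hi]
      rw [e]
      exact ⟨stdMsl (lam i)⟩
  choose Mi hT h1 h2 using key
  exact ⟨Mi, h1, h2, realizesTensor Mi (fun j => (hT j).some) S⟩

end
end StdSec7

noncomputable section StdSec8

section
variable {K : Type*} [Field K] [CharZero K] {n m : ℕ}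

def wl (hmn : m ≤ n) (w : Fin n → ℤ) : Fin m → ℤ := fun j => w ⟨j, by omega⟩
def wr (w : Fin n → ℤ) : Fin (n - m) → ℤ := fun j => w ⟨m + j, by omega⟩

lemma wlr_ext (hmn : m ≤ n) (w w' : Fin n → ℤ) (h1 : wl hmn w = wl hmn w') (h2 : wr (m := m) w = wr w') : w = w' := by
  funext i
  by_cases hi : (i : ℕ) < m
  · exact congrFun h1 ⟨i, hi⟩
  · have := congrFun h2 ⟨i - m, by omega⟩
    simp only [wr] at this
    have e : (⟨m + (i - m), by omega⟩ : Fin n) = i := Fin.ext (by simp; omega)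
    rwa [e] at this

lemma wl_single_lt (hmn : m ≤ n) (i : Fin n) (hi : (i : ℕ) < m) (z : ℤ) :
    wl hmn (Pi.single i z) = Pi.single ⟨i, hi⟩ z := by
  funext j
  simp only [wl, Pi.single_apply, Fin.ext_iff]

lemma wr_single_lt (i : Fin n) (hi : (i : ℕ) < m) (z : ℤ) :
    wr (m := m) (Pi.single i z) = 0 := by
  funext j
  simp only [wr, Pi.single_apply, Fin.ext_iff, Pi.zero_apply]
  rw [if_neg (by omega)]

lemma wl_single_ge (hmn : m ≤ n) (i : Fin n) (hi : m ≤ (i : ℕ)) (z : ℤ) :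
    wl hmn (Pi.single i z) = 0 := by
  funext j
  simp only [wl, Pi.single_apply, Fin.ext_iff, Pi.zero_apply]
  rw [if_neg (by omega)]

lemma wr_single_ge (i : Fin n) (hi : m ≤ (i : ℕ)) (z : ℤ) :
    wr (m := m) (Pi.single i z) = Pi.single ⟨i - m, by omega⟩ z := by
  funext j
  simp only [wr, Pi.single_apply, Fin.ext_iff]
  congr 1
  simp only [eq_iff_iff]
  omega

lemma wl_add (hmn : m ≤ n) (w w' : Fin n → ℤ) : wl hmn (w + w') = wl hmn w + wl hmn w' := rfl
lemma wr_add (w w' : Fin n → ℤ) : wr (m := m) (w + w') = wr w + wr w' := rfl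
lemma wl_sub (hmn : m ≤ n) (w w' : Fin n → ℤ) : wl hmn (w - w') = wl hmn w - wl hmn w' := rfl
lemma wr_sub (w w' : Fin n → ℤ) : wr (m := m) (w - w') = wr w - wr w' := rfl

def glue (u : Fin m → ℤ) (v : Fin (n - m) → ℤ) : Fin n → ℤ :=
  fun i => if h : (i : ℕ) < m then u ⟨i, h⟩ else v ⟨i - m, by omega⟩

lemma wl_glue (hmn : m ≤ n) (u : Fin m → ℤ) (v : Fin (n - m) → ℤ) : wl hmn (glue u v) = u := by
  funext j; simp [wl, glue]
lemma wr_glue (u : Fin m → ℤ) (v : Fin (n - m) → ℤ) : wr (m := m) (glue u v) = v := by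
  funext j; simp [wr, glue]

def tSplit {A : Type*} [Zero A] (t : Fin (n - m) → A) : Fin n → A :=
  fun i => if h : (i : ℕ) < m then 0 else t ⟨i - m, by omega⟩

variable {lam : Fin n → K} (hlam : ∀ i : Fin n, (i : ℕ) < m → lam i = 0)
    {A : Type*} [CommRing A] [Algebra K A] {t : Fin (n - m) → A}
    {N : Type*} [AddCommGroup N] [Module K N] [Module A N] [IsScalarTower K A N]
    {B : Type*} [AddCommGroup B] [Module K B] [Module (In K (n - m)) B]
    [IsScalarTower K (In K (n - m)) B]
    (S : Std ∅ (fun j => lam ⟨m + j, by omega⟩) t N B)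
    {V : Type*} [AddCommGroup V] [Module K V] [Module (In K n) V]
    [IsScalarTower K (In K n) V]

include hlam S in
theorem std_split (hmn : m ≤ n) (hV : RealizesSplit K n m (P K m) B V) :
    Nonempty (Std {i : Fin n | (i : ℕ) < m} lam (tSplit t) N V) := by
  obtain ⟨φ, h1, h2⟩ := hV
  let ι : (Fin n → ℤ) → N →ₗ[K] V := fun w =>
    φ.symm.toLinearMap ∘ₗ TensorProduct.mk K (P K m) B (stdP.ι (wl hmn w) (1 : K)) ∘ₗ S.ι (wr w)
  have hι : ∀ w y, φ (ι w y) = stdP.ι (wl hmn w) (1 : K) ⊗ₜ[K] S.ι (wr w) y := fun w y =>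
    φ.apply_symm_apply _
  let π : (Fin n → ℤ) → V →ₗ[K] N := fun w =>
    (TensorProduct.lid K N).toLinearMap ∘ₗ TensorProduct.map (stdP.π (wl hmn w)) (S.π (wr w)) ∘ₗ φ.toLinearMap
  have hπ : ∀ w w' y, π w (ι w' y) = stdP.π (wl hmn w) (stdP.ι (wl hmn w') (1 : K)) • S.π (wr w) (S.ι (wr w') y) := by
    intro w w' y
    show TensorProduct.lid K N (TensorProduct.map (stdP.π (wl hmn w)) (S.π (wr w)) (φ (ι w' y))) = _
    rw [hι, TensorProduct.map_tmul, TensorProduct.lid_tmul]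
  refine ⟨⟨ι, π, hlam, fun i hi => dif_pos hi, ?_, ?_, ?_, ?_, ?_, ?_, ?_⟩⟩
  · intro w i hi hw
    ext y
    apply φ.injective
    rw [hι, stdP.zero (wl hmn w) ⟨i, hi⟩ trivial hw]
    simp
  · intro w hw y
    rw [hπ, stdP.π_same (wl hmn w) (fun (j : Fin m) _ => hw ⟨j, by omega⟩ j.2), S.π_same _ (by simp), one_smul]
  · intro w w' hne y
    rw [hπ]
    by_cases h : wl hmn w = wl hmn w'
    · rw [S.π_ne _ _ (fun h' => hne (wlr_ext hmn _ _ h h')), smul_zero]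
    · rw [stdP.π_ne _ _ h, zero_smul]
  · intro v
    have key : ∀ x, φ.symm x ∈ ⨆ w, LinearMap.range (ι w) := by
      intro x
      induction x using TensorProduct.induction_on with
      | zero => simp
      | add x y hx hy => rw [map_add]; exact add_mem hx hy
      | tmul a b =>
        refine stdP.ind (p := fun a => φ.symm (a ⊗ₜ[K] b) ∈ ⨆ w, LinearMap.range (ι w)) (by simp)
          (fun w hw c => ?_) (fun u v hu hv => by rw [TensorProduct.add_tmul, map_add]; exact add_mem hu hv) a
        refine S.ind (p := fun b => φ.symm (stdP.ι w c ⊗ₜ[K] b) ∈ ⨆ w, LinearMap.range (ι w)) (by simp)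
          (fun w' hw' y => ?_) (fun u v hu hv => by rw [TensorProduct.tmul_add, map_add]; exact add_mem hu hv) b
        refine Submodule.mem_iSup_of_mem (glue w w') ⟨c • y, ?_⟩
        apply φ.injective
        rw [hι, φ.apply_symm_apply, wl_glue, wr_glue, map_smul, ← TensorProduct.smul_tmul, ← map_smul]
        simp
    have := key (φ v)
    rwa [φ.symm_apply_apply] at this
  · intro i w y
    apply φ.injective
    rw [hι, wl_sub, wr_sub]
    by_cases hi : (i : ℕ) < m
    · rw [(h1 i hi _).2.1, hι, LinearMap.rTensor_tmul, wl_single_lt hmn i hi, wr_single_lt i hi, sub_zero]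
      congr 1
      exact stdP.hd _ _ _
    · have hi := not_lt.1 hi
      rw [(h2 i hi _).2.1, hι, LinearMap.lTensor_tmul, wl_single_ge hmn i hi, wr_single_ge i hi, sub_zero]
      congr 1
      exact S.hd _ _ _
  · intro i w y hw
    apply φ.injective
    rw [hι, wl_add, wr_add]
    by_cases hi : (i : ℕ) < m
    · rw [(h1 i hi _).2.2, hι, LinearMap.rTensor_tmul, wl_single_lt hmn i hi, wr_single_lt i hi, add_zero]
      congr 1
      exact stdP.hint _ _ _ (fun _ => hw hi)
    · have hi := not_lt.1 hi
      rw [(h2 i hi _).2.2, hι, LinearMap.lTensor_tmul, wl_single_ge hmn i hi, wr_single_ge i hi, add_zero]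
      congr 1
      exact S.hint _ _ _ (by simp)
  · intro i w y
    apply φ.injective
    rw [hι, wl_add, wr_add]
    by_cases hi : (i : ℕ) < m
    · rw [(h1 i hi _).1, hι, LinearMap.rTensor_tmul, wl_single_lt hmn i hi, wr_single_lt i hi, add_zero]
      have e : tSplit t i = 0 := dif_pos hi
      rw [e, zero_smul, add_zero, map_smul, ← TensorProduct.smul_tmul, ← map_smul, hlam i hi]
      congr 1
      refine (stdP.hx _ _ _).trans ?_
      congr 1
      simp [wl]
    · have hi' := not_lt.1 hi
      rw [(h2 i hi' _).1, hι, LinearMap.lTensor_tmul, wl_single_ge hmn i hi', wr_single_ge i hi', add_zero]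
      congr 1
      refine (S.hx _ _ _).trans ?_
      have e : tSplit t i = t ⟨i - m, by omega⟩ := dif_neg hi
      have e' : (⟨m + (i - m), by omega⟩ : Fin n) = i := Fin.ext (by simp; omega)
      rw [e]
      simp only [wr, e']

theorem inGWD {A : Type*} [CommRing A] [Algebra K A] {t : Fin n → A}
    {D : Set (Fin n)} (S : Std D lam t A V) (hgen : Algebra.adjoin K (Set.range t) = ⊤)
    (ht : ∀ i, IsNilpotent (t i)) [Nontrivial A] : InGWD K n lam D V := by
  refine ⟨S.isGenWeight ht, ?_, fun p q hpq hs => ?_⟩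
  · rw [S.supp_eq ht]
    rintro mu ⟨h1, h2⟩ i
    by_cases hi : i ∈ D
    · obtain ⟨k, -, hk⟩ := h1 i hi
      exact ⟨k, by rw [hk, S.lam0 i hi]; simp⟩
    · obtain ⟨k, hk⟩ := h2 i hi
      exact ⟨k, by rw [hk]; simp⟩
  · obtain ⟨S'⟩ := S.subq hgen ht p q hpq hs
    exact realizesMD S'

lemma tSplit_gen {A : Type*} [CommRing A] [Algebra K A] {t : Fin (n - m) → A}
    (h : Algebra.adjoin K (Set.range t) = ⊤) :
    Algebra.adjoin K (Set.range (tSplit (n := n) (m := m) t)) = ⊤ := by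
  rw [eq_top_iff, ← h]
  apply Algebra.adjoin_mono
  rintro _ ⟨j, rfl⟩
  exact ⟨⟨m + j, by omega⟩, by simp [tSplit]⟩

lemma tSplit_nil {A : Type*} [CommRing A] {t : Fin (n - m) → A}
    (h : ∀ i, IsNilpotent (t i)) (i) : IsNilpotent (tSplit (n := n) (m := m) t i) := by
  unfold tSplit
  split_ifs
  · exact IsNilpotent.zero
  · exact h _

lemma split_congr {A B C V : Type*} [AddCommGroup A] [Module K A] [Module (In K m) A] [IsScalarTower K (In K m) A]
    [AddCommGroup B] [Module K B] [Module (In K (n - m)) B] [IsScalarTower K (In K (n - m)) B]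
    [AddCommGroup C] [Module K C] [Module (In K (n - m)) C] [IsScalarTower K (In K (n - m)) C]
    [AddCommGroup V] [Module K V] [Module (In K n) V] [IsScalarTower K (In K n) V]
    (e : B ≃ₗ[In K (n - m)] C) (hV : RealizesSplit K n m A B V) : RealizesSplit K n m A C V := by
  obtain ⟨φ, h1, h2⟩ := hV
  let e' : B ≃ₗ[K] C := { e.toAddEquiv with
    map_smul' := fun c v => by
      show e (c • v) = c • e v
      rw [← algebraMap_smul (In K (n - m)) c v, map_smul, algebraMap_smul] }
  have key1 : ∀ (f : A →ₗ[K] A) x, TensorProduct.congr (LinearEquiv.refl K A) e' (LinearMap.rTensor B f x)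
      = LinearMap.rTensor C f (TensorProduct.congr (LinearEquiv.refl K A) e' x) := by
    intro f x
    induction x using TensorProduct.induction_on with
    | zero => simp
    | tmul a b => simp
    | add x y hx hy => rw [map_add, map_add, hx, hy, map_add, map_add]
  have key2 : ∀ (a : In K (n - m)) x, TensorProduct.congr (LinearEquiv.refl K A) e' (LinearMap.lTensor A (DistribMulAction.toLinearMap K B a) x)
      = LinearMap.lTensor A (DistribMulAction.toLinearMap K C a) (TensorProduct.congr (LinearEquiv.refl K A) e' x) := by
    intro a x
    induction x using TensorProduct.induction_on with
    | zero => simp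
    | tmul c b =>
      rw [LinearMap.lTensor_tmul, TensorProduct.congr_tmul, TensorProduct.congr_tmul, LinearMap.lTensor_tmul]
      congr 1
      exact map_smul e a b
    | add x y hx hy => rw [map_add, map_add, hx, hy, map_add, map_add]
  refine ⟨φ.trans (TensorProduct.congr (LinearEquiv.refl K A) e'), fun i hi v => ?_, fun i hi v => ?_⟩
  · simp only [LinearEquiv.trans_apply]
    rw [(h1 i hi v).1, (h1 i hi v).2.1, (h1 i hi v).2.2, key1, key1, key1]
    exact ⟨rfl, rfl, rfl⟩
  · simp only [LinearEquiv.trans_apply]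
    rw [(h2 i hi v).1, (h2 i hi v).2.1, (h2 i hi v).2.2, key2, key2, key2]
    exact ⟨rfl, rfl, rfl⟩

end

section
variable {K : Type*} [Field K] [CharZero K] {n : ℕ} (I : Ideal (Dn K n))

lemma mk_dsmul (d : Dn K n) (b : Bn K n) (J : Submodule (Bn K n) (Bn K n)) (hd : bnD K n d ∈ J) :
    J.mkQ (d • b) = 0 := by
  rw [Submodule.mkQ_apply, Submodule.Quotient.mk_eq_zero]
  exact J.smul_mem b hd

def iso1 : (Bn K n ⧸ Submodule.span (Bn K n) (bnD K n '' (I : Set (Dn K n)))) →ₗ[Bn K n]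
    Ind K n (Dn K n ⧸ I) :=
  Submodule.liftQ _ (LinearMap.toSpanSingleton (Bn K n) (Ind K n (Dn K n ⧸ I)) (indT 1 1)) (by
    rw [Submodule.span_le]
    rintro _ ⟨d, hd, rfl⟩
    show ((bnD K n d * 1) ⊗ₜ[Dn K n] (1 : Dn K n ⧸ I) : Bn K n ⊗[Dn K n] (Dn K n ⧸ I)) = 0
    have : bnD K n d * 1 = d • (1 : Bn K n) := by
      show _ = 1 * bnD K n d
      rw [mul_one, one_mul]
    rw [this, TensorProduct.smul_tmul]
    have : d • (1 : Dn K n ⧸ I) = Ideal.Quotient.mk I d := by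
      rw [Algebra.smul_def, mul_one]; rfl
    rw [this, Ideal.Quotient.eq_zero_iff_mem.2 hd, TensorProduct.tmul_zero])

lemma iso1_mk (b : Bn K n) : iso1 I (Submodule.Quotient.mk b) = indT b 1 := by
  show ((b * 1) ⊗ₜ[Dn K n] (1 : Dn K n ⧸ I) : Bn K n ⊗[Dn K n] (Dn K n ⧸ I)) = b ⊗ₜ[Dn K n] (1 : Dn K n ⧸ I)
  rw [mul_one]

def iso2 : Ind K n (Dn K n ⧸ I) →+
    (Bn K n ⧸ Submodule.span (Bn K n) (bnD K n '' (I : Set (Dn K n)))) :=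
  TensorProduct.liftAddHom
    { toFun := fun b => QuotientAddGroup.lift (Submodule.toAddSubgroup I)
        { toFun := fun d => Submodule.Quotient.mk (d • b)
          map_zero' := by rw [zero_smul]; rfl
          map_add' := fun d d' => by rw [add_smul]; rfl }
        (fun d hd => mk_dsmul d b _ (Submodule.subset_span ⟨d, hd, rfl⟩))
      map_zero' := by
        ext y
        obtain ⟨d, rfl⟩ := Ideal.Quotient.mk_surjective y
        show Submodule.Quotient.mk (d • (0 : Bn K n)) = _
        rw [smul_zero]; rfl
      map_add' := fun b b' => by
        ext y
        obtain ⟨d, rfl⟩ := Ideal.Quotient.mk_surjective y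
        exact congrArg (Submodule.Quotient.mk (p := Submodule.span (Bn K n) (bnD K n '' (I : Set (Dn K n))))) (smul_add d b b') }
    (by
      intro d b y
      obtain ⟨e, rfl⟩ := Ideal.Quotient.mk_surjective y
      have h : (d * e) • b = e • d • b := by
        show b * bnD K n (d * e) = (b * bnD K n d) * bnD K n e
        rw [map_mul, mul_assoc]
      exact (congrArg (Submodule.Quotient.mk (p := Submodule.span (Bn K n) (bnD K n '' (I : Set (Dn K n))))) h).symm)

lemma iso2_t (b : Bn K n) (d : Dn K n) : iso2 I (indT b (Ideal.Quotient.mk I d)) = Submodule.Quotient.mk (d • b) := rfl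

def isoI : Ind K n (Dn K n ⧸ I) ≃ₗ[In K n]
    (Bn K n ⧸ Submodule.span (Bn K n) (bnD K n '' (I : Set (Dn K n)))) :=
  LinearEquiv.symm
  { toFun := iso1 I
    map_add' := map_add _
    map_smul' := fun a v => map_smul (iso1 I) (toBn K n a) v
    invFun := iso2 I
    left_inv := by
      intro v
      obtain ⟨b, rfl⟩ := Submodule.Quotient.mk_surjective _ v
      rw [iso1_mk]
      refine (iso2_t I b 1).trans ?_
      rw [one_smul]
    right_inv := by
      intro v
      refine TensorProduct.induction_on (motive := fun v => iso1 I (iso2 I v) = v) v ?_ ?_ ?_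
      · exact (congrArg _ (map_zero (iso2 I))).trans (map_zero (iso1 I))
      · intro b y
        obtain ⟨d, rfl⟩ := Ideal.Quotient.mk_surjective y
        refine (congrArg _ (iso2_t I b d)).trans ?_
        rw [iso1_mk]
        show ((d • b) ⊗ₜ[Dn K n] (1 : Dn K n ⧸ I) : Bn K n ⊗[Dn K n] (Dn K n ⧸ I)) = _
        rw [TensorProduct.smul_tmul]
        have h : d • (1 : Dn K n ⧸ I) = Ideal.Quotient.mk I d := by
          rw [Algebra.smul_def, mul_one]; rfl
        rw [h]
      · intro x y hx hy
        exact (congrArg _ (map_add (iso2 I) x y)).trans ((map_add (iso1 I) _ _).trans (congrArg₂ (· + ·) hx hy)) }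

end
end StdSec8

/-- for `𝔻_Ω = {1,…,l}`, `𝒟_Ω = {1,…,m}` (`1 ≤ m ≤ l ≤ n`) and
`𝔪' ⊇ I ⊇ 𝔪'^k`, the module `V(I) = P_m ⊗ (B_{n-m} ⊗_{D_{n-m}} D_{n-m}/I)` lies in
`GW(𝕀_n, 𝒟_Ω)` and is an indecomposable equidimensional generalized weight module of length
`d = dim_K(D_{n-m}/I) < ∞`, isomorphic to `P_m ⊗ B_{n-m}/B_{n-m} I`, with all
generalized weight spaces of dimension `d` on `Supp(M(𝒟_Ω))`, and annihilator the prime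
ideal `Σ_{i ∉ 𝒟_Ω} 𝔭_i`. -/
theorem statement12 (K : Type*) [Field K] [CharZero K] (n : ℕ)
    (lam : Fin n → K) (hnorm : IsNormalized K n lam)
    (m l : ℕ) (hm : 1 ≤ m) (hml : m ≤ l) (hln : l ≤ n)
    (hDD : DD K n lam = {i : Fin n | (i : ℕ) < l})
    (I : Ideal (Dn K (n - m)))
    (hIm : I ≤ mIdeal K (n - m) (fun j => lam ⟨m + (j : ℕ), by omega⟩))
    (k : ℕ) (hk : 1 ≤ k)
    (hmk : mIdeal K (n - m) (fun j => lam ⟨m + (j : ℕ), by omega⟩) ^ k ≤ I)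
    (V : Type*) [AddCommGroup V] [Module K V] [Module (In K n) V]
    [IsScalarTower K (In K n) V]
    (hV : RealizesSplit K n m (P K m) (Ind K (n - m) (Dn K (n - m) ⧸ I)) V) :
    FiniteDimensional K (Dn K (n - m) ⧸ I) ∧
    InGWD K n lam {i : Fin n | (i : ℕ) < m} V ∧
    IsGenWeightModule K n V ∧
    IsIndecomposableMod K n V ∧
    supp K n V = SuppMD K n lam {i : Fin n | (i : ℕ) < m} ∧
    (∀ mu ∈ supp K n V,
      Module.finrank K (genWeightSpace K n V mu) = Module.finrank K (Dn K (n - m) ⧸ I)) ∧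
    (∃ s : CompositionSeries (Submodule (In K n) V),
      s.head = ⊥ ∧ s.last = ⊤ ∧ s.length = Module.finrank K (Dn K (n - m) ⧸ I)) ∧
    RealizesSplit K n m (P K m)
      (Bn K (n - m) ⧸ Submodule.span (Bn K (n - m)) (bnD K (n - m) '' (I : Set (Dn K (n - m))))) V ∧
    annSet K n V = (aIdeal K n {i : Fin n | m ≤ (i : ℕ)} : Set (In K n)) ∧
    IsPrimeSet K n (aIdeal K n {i : Fin n | m ≤ (i : ℕ)} : Set (In K n)) := by
  have hmn : m ≤ n := hml.trans hln
  have hlam : ∀ i : Fin n, (i : ℕ) < m → lam i = 0 := by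
    intro i hi
    apply hnorm
    have : i ∈ DD K n lam := by
      rw [hDD]
      exact lt_of_lt_of_le hi hml
    exact this
  have hgen := tSplit_gen (n := n) (m := m) (tI_gen I (fun j => lam ⟨m + (j : ℕ), by omega⟩))
  have ht := tSplit_nil (n := n) (m := m) (tI_nil I (fun j => lam ⟨m + (j : ℕ), by omega⟩) hmk)
  have hfin : FiniteDimensional K (Dn K (n - m) ⧸ I) := fin_of_nil hgen ht
  have hnt : Nontrivial (Dn K (n - m) ⧸ I) := Ideal.Quotient.nontrivial_iff.2 (by
    intro h
    rw [h, top_le_iff] at hIm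
    exact mIdeal_ne_top _ hIm)
  obtain ⟨S⟩ := std_split hlam (stdInd I (fun j => lam ⟨m + (j : ℕ), by omega⟩)) hmn hV
  have hc : {i : Fin n | m ≤ (i : ℕ)} = {i : Fin n | (i : ℕ) < m}ᶜ := by
    ext i; simp
  refine ⟨hfin, inGWD S hgen ht, S.isGenWeight ht, S.indec hgen ht, S.supp_eq ht, ?_,
    S.series hgen ht, split_congr (isoI I) hV, ?_, ?_⟩
  · intro mu hmu
    obtain ⟨w, hw, rfl⟩ := (S.mem_supp ht mu).1 hmu
    exact S.finrank_gws ht w hw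
  · rw [hc]
    exact S.annSet_eq ht
  · rw [hc]
    exact S.isPrime hgen ht

end IDO
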